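/- arXiv:1301.0226 — 3 statements merged into one kernel-verified Lean document; each statement's English description precedes it below -/
import Mathlib

section
/- Let n ≥ 2, let a ∈ (0,1), and let p(z) = (z−a)·∏_{k=1}^{n−1}(z−z_k) with |z_k| ≤ 1 for all k. Suppose every zero ζ of p′ satisfies |ζ − a| ≥ 1. Let λ be a real number with 1 − (1 − |p(0)|)^{1/n} ≤ λ ≤ sin(π/n) and λ < a. Then there exists a zero ζ₀ of p′ (a critical point of p) such that Re ζ₀ ≥ (1/2)·(a − λ(λ+2)/a). -/
open Polynomial Real Complex

theorem Multiset.sq_norm_sum_le (s : Multiset ℂ) :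
    ‖s.sum‖ ^ 2 ≤ s.card * (s.map fun w => ‖w‖ ^ 2).sum := by
  induction s using Multiset.induction_on with
  | empty => simp
  | cons w s ih =>
    have hQ : 0 ≤ (s.map fun w => ‖w‖ ^ 2).sum :=
      Multiset.sum_nonneg (by simp only [Multiset.mem_map]; rintro _ ⟨v, -, rfl⟩; positivity)
    rw [Multiset.sum_cons, Multiset.map_cons, Multiset.sum_cons, Multiset.card_cons]
    push_cast
    set S := s.sum
    set Q := (s.map fun w => ‖w‖ ^ 2).sum
    have h1 : ‖w + S‖ ^ 2 ≤ (‖w‖ + ‖S‖) ^ 2 := by gcongr; exact norm_add_le _ _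
    have h2 : 2 * (‖S‖ * ‖w‖) ≤ Q + s.card * ‖w‖ ^ 2 := by
      rcases Nat.eq_zero_or_pos s.card with h0 | h0
      · have : ‖S‖ = 0 := by
          have := Multiset.card_eq_zero.mp h0
          simp [S, this]
        rw [this, h0]; simpa using hQ
      · have hd : (0 : ℝ) < s.card := by exact_mod_cast h0
        have : s.card * (2 * (‖S‖ * ‖w‖)) ≤ s.card * (Q + s.card * ‖w‖ ^ 2) := by
          nlinarith [sq_nonneg (‖S‖ - s.card * ‖w‖)]
        exact le_of_mul_le_mul_left this hd
    nlinarith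

/-- If every `w` in a nonempty multiset of complex numbers satisfies `x * ‖w‖ ^ 2 < w.re` for some
`x ≥ 0`, then so does, up to normalization, the sum. -/
theorem Multiset.mul_sq_norm_sum_lt {x : ℝ} (hx : 0 ≤ x) {s : Multiset ℂ} (hs : s ≠ 0)
    (h : ∀ w ∈ s, x * ‖w‖ ^ 2 < w.re) : x * ‖s.sum‖ ^ 2 < s.card * s.sum.re := by
  have h1 : (s.map fun w => x * ‖w‖ ^ 2).sum < (s.map fun w => w.re).sum :=
    Multiset.sum_lt_sum_of_nonempty hs h
  have h2 : (s.map fun w => w.re).sum = s.sum.re :=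
    (map_multiset_sum Complex.reAddGroupHom s).symm
  rw [Multiset.sum_map_mul_left, h2] at h1
  have hd : (0 : ℝ) < s.card := by exact_mod_cast Multiset.card_pos.mpr hs
  nlinarith [mul_le_mul_of_nonneg_left s.sq_norm_sum_le hx, mul_lt_mul_of_pos_left h1 hd]

/-- The polar derivative of `f`, seen as a polynomial of formal degree `m`, with pole `-1 / ω`
(and scaled by `ω`). -/
noncomputable def polarDeriv (m : ℕ) (ω : ℂ) (f : ℂ[X]) : ℂ[X] :=
  (1 + C ω * X) * derivative f - C (m * ω) * f

theorem coeff_polarDeriv (m : ℕ) (ω : ℂ) (f : ℂ[X]) (k : ℕ) :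
    (polarDeriv m ω f).coeff k = (k + 1) * f.coeff (k + 1) - ω * (m - k) * f.coeff k := by
  have : polarDeriv m ω f = derivative f + C ω * (X * derivative f) - C (m * ω) * f := by
    rw [polarDeriv]; ring
  rw [this, coeff_sub, coeff_add, coeff_C_mul, coeff_C_mul, coeff_derivative]
  cases k with
  | zero => simp [mul_comm]
  | succ k => rw [coeff_X_mul, coeff_derivative]; push_cast; ring

theorem natDegree_polarDeriv_le {m : ℕ} {f : ℂ[X]} (hf : f.natDegree ≤ m + 1) (ω : ℂ) :
    (polarDeriv (m + 1) ω f).natDegree ≤ m := by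
  rw [natDegree_le_iff_coeff_eq_zero]
  intro k hk
  rw [coeff_polarDeriv, coeff_eq_zero_of_natDegree_lt (by lia : f.natDegree < k + 1)]
  rcases Nat.lt_or_ge (m + 1) k with h | h
  · rw [coeff_eq_zero_of_natDegree_lt (by lia : f.natDegree < k)]; simp
  · obtain rfl : k = m + 1 := by lia
    simp

/-- Laguerre's theorem for the half-plane `Re < 0`, with a pole on the imaginary axis. -/
theorem eval_polarDeriv_ne_zero {m : ℕ} {f : ℂ[X]} (hm : 0 < m) (hf : f.natDegree ≤ m)
    (hroot : ∀ z : ℂ, 0 ≤ z.re → f.eval z ≠ 0) {ω : ℂ} (hω : ω ≠ 0) (hre : ω.re = 0)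
    {z : ℂ} (hz : 0 ≤ z.re) : (polarDeriv m ω f).eval z ≠ 0 := by
  intro h0
  have hfz := hroot z hz
  simp only [polarDeriv, eval_sub, eval_mul, eval_add, eval_one, eval_C, eval_X] at h0
  have hlog := (IsAlgClosed.splits f).eval_derivative_div_eval_of_ne_zero hfz
  set s : Multiset ℂ := f.roots.map fun τ => 1 / (z - τ) with hs
  have hcard : s.card ≤ m := by
    rw [hs, Multiset.card_map]; exact (card_roots' f).trans hf
  have hmS : (1 + ω * z) * s.sum = m * ω := by
    rw [← hlog, mul_div_assoc', div_eq_iff hfz]; linear_combination h0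
  have hmC : (m : ℂ) ≠ 0 := by exact_mod_cast hm.ne'
  have hS : s.sum ≠ 0 := by
    intro h; rw [h, mul_zero] at hmS
    exact mul_ne_zero hmC hω hmS.symm
  have hs0 : s ≠ 0 := by rintro h; exact hS (by rw [h]; simp)
  have key := Multiset.mul_sq_norm_sum_lt hz hs0 (by
    intro w hw
    obtain ⟨τ, hτ, rfl⟩ := Multiset.mem_map.mp hw
    have hτre : τ.re < 0 := by
      by_contra! hc
      exact hroot τ hc (isRoot_of_mem_roots hτ)
    have hne : z - τ ≠ 0 := by
      intro h
      have := congrArg Complex.re h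
      simp at this; linarith
    have hpos : 0 < Complex.normSq (z - τ) := Complex.normSq_pos.mpr hne
    rw [one_div, ← Complex.normSq_eq_norm_sq, Complex.normSq_inv, Complex.inv_re,
      ← div_eq_mul_inv, div_lt_div_iff_of_pos_right hpos, Complex.sub_re]
    linarith)
  have hSpos : 0 < ‖s.sum‖ ^ 2 := by have := norm_pos_iff.mpr hS; positivity
  have hre0 : 0 ≤ s.sum.re := by
    have hd : (0 : ℝ) < s.card := by exact_mod_cast Multiset.card_pos.mpr hs0
    by_contra! hc
    nlinarith [mul_nonneg hz hSpos.le]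
  have hle : (s.card : ℝ) * s.sum.re ≤ m * s.sum.re := by gcongr
  have hb : ω.im ≠ 0 := by
    intro h; exact hω (Complex.ext hre h)
  have e1 := congrArg Complex.re hmS
  have e2 := congrArg Complex.im hmS
  simp [hre] at e1 e2
  have : z.re * ‖s.sum‖ ^ 2 = m * s.sum.re := by
    rw [← Complex.normSq_eq_norm_sq, Complex.normSq_apply]
    apply mul_left_cancel₀ hb
    linear_combination (-s.sum.im) * e1 + s.sum.re * e2
  linarith

/-- Grace's apolarity pairing of two polynomials of formal degree `m`. -/
noncomputable def apolarPairing (m : ℕ) (f g : ℂ[X]) : ℂ :=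
  ∑ k ∈ Finset.range (m + 1), f.coeff k / m.choose k * g.coeff k

theorem apolarPairing_polarDeriv (m : ℕ) (ω : ℂ) (f : ℂ[X]) {g : ℂ[X]} (hg : g.natDegree ≤ m) :
    apolarPairing m (polarDeriv (m + 1) ω f) g =
      (m + 1) * apolarPairing (m + 1) f ((X - C ω) * g) := by
  have e : ∀ k, ((X - C ω) * g).coeff (k + 1) = g.coeff k - ω * g.coeff (k + 1) := fun k => by
    rw [sub_mul, coeff_sub, coeff_X_mul, coeff_C_mul]
  have e0 : ((X - C ω) * g).coeff 0 = - ω * g.coeff 0 := by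
    rw [sub_mul, coeff_sub, coeff_C_mul]; simp
  have hlast : g.coeff (m + 1) = 0 := coeff_eq_zero_of_natDegree_lt (by lia)
  have hR : apolarPairing (m + 1) f ((X - C ω) * g) =
      ∑ k ∈ Finset.range (m + 1), (f.coeff (k + 1) / (m + 1).choose (k + 1) * g.coeff k
        - f.coeff k / (m + 1).choose k * (ω * g.coeff k)) := by
    rw [Finset.sum_sub_distrib, apolarPairing, Finset.sum_range_succ']
    simp only [e, e0, mul_sub, Finset.sum_sub_distrib]
    have := Finset.sum_range_succ' (fun k => f.coeff k / (m + 1).choose k * (ω * g.coeff k)) (m + 1)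
    rw [Finset.sum_range_succ, hlast] at this
    linear_combination this
  rw [hR, apolarPairing, Finset.mul_sum]
  refine Finset.sum_congr rfl fun k hk => ?_
  have hkm : k ≤ m := by simpa [Nat.lt_succ_iff] using hk
  rw [coeff_polarDeriv]
  have c0 : (m.choose k : ℂ) ≠ 0 := by exact_mod_cast (Nat.choose_pos hkm).ne'
  have c1 : ((m + 1).choose k : ℂ) ≠ 0 := by
    exact_mod_cast (Nat.choose_pos (hkm.trans m.le_succ)).ne'
  have c2 : ((m + 1).choose (k + 1) : ℂ) ≠ 0 := by
    exact_mod_cast (Nat.choose_pos (Nat.succ_le_succ hkm)).ne'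
  have r1 : ((m : ℂ) + 1) * m.choose k = (m + 1).choose (k + 1) * (k + 1) := by
    exact_mod_cast Nat.add_one_mul_choose_eq m k
  have r2 : (m.choose k : ℂ) * (m + 1) = (m + 1).choose k * (m + 1 - k) := by
    have := congrArg (Nat.cast (R := ℂ)) (Nat.choose_mul_succ_eq m k)
    push_cast [Nat.cast_sub (hkm.trans m.le_succ)] at this
    exact this
  have h1 : ((k : ℂ) + 1) / m.choose k = (m + 1) / (m + 1).choose (k + 1) := by
    rw [div_eq_div_iff c0 c2]; linear_combination -r1
  have h2 : ((m : ℂ) + 1 - k) / m.choose k = (m + 1) / (m + 1).choose k := by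
    rw [div_eq_div_iff c0 c1]; linear_combination -r2
  push_cast
  linear_combination (f.coeff (k + 1) * g.coeff k) * h1 - (ω * f.coeff k * g.coeff k) * h2

/-- Grace's theorem for the half-plane `Re < 0` against roots on the punctured imaginary axis. -/
theorem apolarPairing_prod_ne_zero (s : Multiset ℂ) :
    ∀ (m : ℕ) (f : ℂ[X]), s.card ≤ m → f.natDegree ≤ m →
      (∀ z : ℂ, 0 ≤ z.re → f.eval z ≠ 0) → (∀ ω ∈ s, ω ≠ 0 ∧ ω.re = 0) →
      apolarPairing m f (s.map fun ω => X - C ω).prod ≠ 0 := by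
  induction s using Multiset.induction_on with
  | empty =>
    intro m f _ _ hroot _
    have : apolarPairing m f 1 = f.eval 0 := by
      rw [apolarPairing, Finset.sum_range_succ']
      simp [coeff_one, coeff_zero_eq_eval_zero]
    simpa [this] using hroot 0 le_rfl
  | cons ω s ih =>
    intro m f hs hf hroot hω
    rw [Multiset.card_cons] at hs
    obtain ⟨m, rfl⟩ : ∃ k, m = k + 1 := ⟨m - 1, by lia⟩
    obtain ⟨hω0, hωre⟩ := hω ω (Multiset.mem_cons_self _ _)
    have h := ih m (polarDeriv (m + 1) ω f) (by lia) (natDegree_polarDeriv_le hf ω)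
      (fun z hz => by
        simpa using eval_polarDeriv_ne_zero m.succ_pos hf hroot hω0 hωre hz)
      (fun v hv => hω v (Multiset.mem_cons_of_mem hv))
    rw [apolarPairing_polarDeriv m ω f
      (by rw [natDegree_multiset_prod_X_sub_C_eq_card]; lia)] at h
    rw [Multiset.map_cons, Multiset.prod_cons]
    exact right_ne_zero_of_mul h

theorem apolarPairing_one_add_X_pow_sub (n : ℕ) {P : ℂ[X]} (hP : P.natDegree ≤ n) :
    apolarPairing n P ((1 + X) ^ n - (1 - X) ^ n) = P.eval 1 - P.eval (-1) := by
  have h : ((1 - X) ^ n : ℂ[X]) = ((1 + X) ^ n).comp (C (-1) * X) := by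
    simp [sub_eq_add_neg]
  rw [eval_eq_sum_range' (Nat.lt_succ_of_le hP), eval_eq_sum_range' (Nat.lt_succ_of_le hP),
    ← Finset.sum_sub_distrib, apolarPairing]
  refine Finset.sum_congr rfl fun k hk => ?_
  have hkm : k ≤ n := by simpa [Nat.lt_succ_iff] using hk
  have c0 : (n.choose k : ℂ) ≠ 0 := by exact_mod_cast (Nat.choose_pos hkm).ne'
  rw [coeff_sub, h, comp_C_mul_X_coeff, coeff_one_add_X_pow]
  field_simp
  simp

/-- A half-plane version of the Grace–Heawood theorem. -/
theorem exists_eval_derivative_eq_zero_of_eval_one_eq {n : ℕ} (hn : 0 < n) {P : ℂ[X]}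
    (hP : P.natDegree ≤ n) (h : P.eval 1 = P.eval (-1)) :
    ∃ t : ℂ, 0 ≤ t.re ∧ P.derivative.eval t = 0 := by
  by_contra! hroot
  obtain ⟨m, rfl⟩ : ∃ k, n = k + 1 := ⟨n - 1, by lia⟩
  set g : ℂ[X] := (1 + X) ^ (m + 1) - (1 - X) ^ (m + 1) with hg
  have hgX : g = X * g.divX := by
    have := divX_mul_X_add g
    rw [show g.coeff 0 = 0 by simp [hg, coeff_zero_eq_eval_zero], C_0, add_zero] at this
    rw [mul_comm, this]
  set q := g.divX with hq
  have hgeval : ∀ x, x * q.eval x = (1 + x) ^ (m + 1) - (1 - x) ^ (m + 1) := fun x => by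
    have := congrArg (eval x) hgX
    rw [eval_mul, eval_X] at this
    rw [← this]; simp [hg]
  have hq0 : q.eval 0 ≠ 0 := by
    have h1 : g.derivative.eval 0 = q.eval 0 := by rw [hgX]; simp
    have h2 : g.derivative.eval 0 = 2 * (m + 1) := by
      simp [hg, derivative_pow]; ring
    rw [← h1, h2]
    exact mul_ne_zero two_ne_zero (by exact_mod_cast m.succ_ne_zero)
  have hqne : q ≠ 0 := by rintro h; simp [h] at hq0
  have hqdeg : q.natDegree ≤ m := by
    rw [hq, natDegree_divX_eq_natDegree_tsub_one]
    have : g.natDegree ≤ m + 1 := by rw [hg]; compute_degree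
    lia
  have hpair : apolarPairing m (derivative P) q = 0 := by
    have h1 := apolarPairing_polarDeriv m 0 P hqdeg
    have h2 := apolarPairing_one_add_X_pow_sub (m + 1) hP
    rw [← hg, h, sub_self] at h2
    rwa [C_0, sub_zero, ← hgX, h2, mul_zero,
      show polarDeriv (m + 1) 0 P = derivative P by simp [polarDeriv]] at h1
  refine apolarPairing_prod_ne_zero q.roots m (derivative P) ((card_roots' q).trans hqdeg)
    ((natDegree_derivative_le P).trans (by lia)) hroot ?_ ?_
  · intro ω hω
    have hω0 : q.eval ω = 0 := isRoot_of_mem_roots hω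
    refine ⟨by rintro rfl; exact hq0 hω0, ?_⟩
    have h1 := hgeval ω
    rw [hω0, mul_zero, eq_comm, sub_eq_zero] at h1
    have h2 : ‖1 + ω‖ = ‖1 - ω‖ := by
      have := congrArg norm h1
      rwa [norm_pow, norm_pow, pow_left_inj₀ (norm_nonneg _) (norm_nonneg _) m.succ_ne_zero] at this
    have h3 : Complex.normSq (1 + ω) = Complex.normSq (1 - ω) := by
      rw [Complex.normSq_eq_norm_sq, Complex.normSq_eq_norm_sq, h2]
    simp [Complex.normSq_apply] at h3
    linarith
  · have h1 := (IsAlgClosed.splits q).eq_prod_roots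
    have h2 : apolarPairing m (derivative P) q =
        q.leadingCoeff * apolarPairing m (derivative P) (q.roots.map fun ω => X - C ω).prod := by
      conv_lhs => rw [h1]
      simp only [apolarPairing, coeff_C_mul, Finset.mul_sum]
      exact Finset.sum_congr rfl fun k _ => by ring
    rw [hpair, eq_comm] at h2
    exact (mul_eq_zero.mp h2).resolve_left (leadingCoeff_ne_zero.mpr hqne)

theorem le_norm_eval_derivative {p : ℂ[X]} (hp : p.Monic) {a : ℂ}
    (hcrit : ∀ ζ : ℂ, p.derivative.eval ζ = 0 → 1 ≤ ‖ζ - a‖) {z : ℂ} (hz : ‖z - a‖ ≤ 1) :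
    p.natDegree * (1 - ‖z - a‖) ^ (p.natDegree - 1) ≤ ‖p.derivative.eval z‖ := by
  have hnorm : ∀ s : Multiset ℂ, ‖s.prod‖ = (s.map fun x => ‖x‖).prod :=
    map_multiset_prod (normHom (α := ℂ))
  have hs := IsAlgClosed.splits p.derivative
  rw [hs.eval_eq_prod_roots, leadingCoeff_derivative, hp.leadingCoeff, one_mul, norm_mul,
    RCLike.norm_natCast, ← natDegree_derivative, hs.natDegree_eq_card_roots,
    ← Multiset.prod_replicate, ← Multiset.map_const', hnorm,
    Multiset.map_map]
  gcongr
  refine Multiset.prod_map_le_prod_map₀ _ _ (fun _ _ => by linarith) fun ζ hζ => ?_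
  have h1 := hcrit ζ (isRoot_of_mem_roots hζ)
  have h2 := norm_sub_le_norm_sub_add_norm_sub ζ z a
  rw [norm_sub_rev ζ z] at h2
  rw [Function.comp_apply]
  linarith

theorem HasDerivAt.nonneg_of_eventually_le {ψ : ℝ → ℝ} {ψ' x : ℝ} (h : HasDerivAt ψ ψ' x)
    (hle : ∀ᶠ t in nhdsWithin 0 (Set.Ioi 0), ψ x ≤ ψ (x + t)) : 0 ≤ ψ' := by
  refine ge_of_tendsto h.tendsto_slope_zero_right ?_
  filter_upwards [hle, self_mem_nhdsWithin] with t ht ht0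
  have : (0 : ℝ) < t := ht0
  simp only [smul_eq_mul]
  exact mul_nonneg (by positivity) (by linarith)

theorem exists_eval_eq_of_norm_sub_lt {p : ℂ[X]} (hp : p.Monic) (hdeg : 0 < p.natDegree) {a : ℂ}
    (hcrit : ∀ ζ : ℂ, p.derivative.eval ζ = 0 → 1 ≤ ‖ζ - a‖) {r : ℝ} (hr0 : 0 ≤ r) (hr1 : r < 1)
    {w : ℂ} (hw : ‖w - p.eval a‖ < 1 - (1 - r) ^ p.natDegree) :
    ∃ z : ℂ, ‖z - a‖ ≤ r ∧ p.eval z = w := by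
  set n := p.natDegree with hn
  have hG : 0 < 1 - (1 - r) ^ n := (norm_nonneg _).trans_lt hw
  obtain ⟨κ, hκ1, hκ2⟩ := exists_between ((div_lt_one hG).mpr hw)
  rw [div_lt_iff₀ hG] at hκ1
  have hκ0 : 0 < κ := by
    by_contra! hc
    nlinarith [norm_nonneg (w - p.eval a)]
  obtain ⟨z, hz, hmin⟩ := (isCompact_closedBall a r).exists_isMinOn
    (f := fun z => ‖p.eval z - w‖ + κ * (1 - (1 - ‖z - a‖) ^ n))
    ⟨a, by simpa using hr0⟩ (by fun_prop)
  rw [mem_closedBall_iff_norm] at hz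
  have hmin' : ∀ y : ℂ, ‖y - a‖ ≤ r → ‖p.eval z - w‖ + κ * (1 - (1 - ‖z - a‖) ^ n) ≤
      ‖p.eval y - w‖ + κ * (1 - (1 - ‖y - a‖) ^ n) := fun y hy =>
    hmin (mem_closedBall_iff_norm.mpr hy)
  refine ⟨z, hz, ?_⟩
  by_contra hne
  have hlt : ‖z - a‖ < r := by
    refine lt_of_le_of_ne hz fun heq => ?_
    have h := hmin' a (by simpa using hr0)
    rw [heq] at h
    simp only [sub_self, norm_zero, sub_zero, one_pow, mul_zero, add_zero] at h
    rw [norm_sub_rev (p.eval a)] at h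
    linarith [norm_nonneg (p.eval z - w)]
  have hbound := le_norm_eval_derivative hp hcrit (hz.trans hr1.le)
  set ρ := ‖z - a‖ with hρ
  set D := p.derivative.eval z with hD
  set d := p.eval z - w with hd
  have hDpos : 0 < ‖D‖ := by
    refine lt_of_lt_of_le ?_ hbound
    have : 0 < 1 - ρ := by linarith
    have : (0 : ℝ) < p.natDegree := by exact_mod_cast hdeg
    positivity
  have hD0 : D ≠ 0 := norm_pos_iff.mp hDpos
  have hdpos : 0 < ‖d‖ := norm_pos_iff.mpr (sub_ne_zero.mpr hne)
  set v := -d / D with hv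
  have hvn : ‖v‖ * ‖D‖ = ‖d‖ := by
    rw [hv, norm_div, norm_neg]; field_simp
  -- the error of the first-order expansion of `p` along the direction `v`
  have herr : HasDerivAt (fun t : ℝ => ‖p.eval (z + t * v) - w - (1 - t) * d‖) 0 0 := by
    have h1 : HasDerivAt (fun t : ℝ => p.eval (z + t * v) - w - (1 - t) * d) 0 0 := by
      have hl : HasDerivAt (fun t : ℝ => z + (t : ℂ) * v) v 0 := by
        simpa using ((Complex.ofRealCLM.hasDerivAt (x := 0)).mul_const v).const_add z
      have hc := HasDerivAt.comp_of_eq (𝕜 := ℝ) (𝕜' := ℂ) 0 (p.hasDerivAt z) hl (by simp)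
      have hd' : HasDerivAt (fun t : ℝ => (1 - (t : ℂ)) * d) (-d) 0 := by
        simpa using ((Complex.ofRealCLM.hasDerivAt (x := 0)).const_sub 1).mul_const d
      have := (hc.sub_const w).sub hd'
      rwa [← hD, hv, mul_div_cancel₀ _ hD0, sub_self] at this
    rw [hasDerivAt_iff_isLittleO] at h1 ⊢
    have h0 : p.eval (z + ((0 : ℝ) : ℂ) * v) - w - (1 - ((0 : ℝ) : ℂ)) * d = 0 := by
      simp [hd]
    simp only [h0, norm_zero, smul_zero, sub_zero] at h1 ⊢
    exact h1.norm_left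
  have hψ : HasDerivAt (fun t : ℝ => (1 - t) * ‖d‖ + ‖p.eval (z + t * v) - w - (1 - t) * d‖ +
      κ * (1 - (1 - (ρ + t * ‖v‖)) ^ n))
      (-‖d‖ + κ * (n * (1 - ρ) ^ (n - 1) * ‖v‖)) 0 := by
    have h1 : HasDerivAt (fun t : ℝ => (1 - t) * ‖d‖) (-‖d‖) 0 := by
      simpa using ((hasDerivAt_id (0 : ℝ)).const_sub 1).mul_const ‖d‖
    have h2 : HasDerivAt (fun t : ℝ => 1 - (ρ + t * ‖v‖)) (-‖v‖) 0 := by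
      simpa using (((hasDerivAt_id (0 : ℝ)).mul_const ‖v‖).const_add ρ).const_sub 1
    have h3 := ((h2.pow n).const_sub 1).const_mul κ
    refine ((h1.add herr).add h3).congr_deriv ?_
    simp
  have hnonneg := hψ.nonneg_of_eventually_le (by
    have hcont : Filter.Tendsto (fun t : ℝ => ρ + t * ‖v‖) (nhds 0) (nhds ρ) := by
      have : Continuous fun t : ℝ => ρ + t * ‖v‖ := by fun_prop
      simpa using this.tendsto 0
    filter_upwards [nhdsWithin_le_nhds (hcont.eventually_lt_const hlt),
      nhdsWithin_le_nhds (eventually_lt_nhds (zero_lt_one' ℝ)),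
      self_mem_nhdsWithin] with t ht ht1 ht0
    replace ht0 : (0 : ℝ) < t := ht0
    have hy : ‖z + t * v - a‖ ≤ ρ + t * ‖v‖ := by
      have : z + t * v - a = (z - a) + t * v := by ring
      rw [this]
      refine (norm_add_le _ _).trans ?_
      rw [norm_mul, Complex.norm_of_nonneg ht0.le]
    have hm := hmin' (z + t * v) (hy.trans ht.le)
    have hpw : ‖p.eval (z + t * v) - w‖ ≤
        (1 - t) * ‖d‖ + ‖p.eval (z + t * v) - w - (1 - t) * d‖ := by
      have := norm_add_le ((1 - (t : ℂ)) * d) (p.eval (z + t * v) - w - (1 - t) * d)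
      rw [add_sub_cancel, norm_mul, ← Complex.ofReal_one, ← Complex.ofReal_sub,
        Complex.norm_of_nonneg (by linarith)] at this
      simpa using this
    have hpow : (1 - (ρ + t * ‖v‖)) ^ n ≤ (1 - ‖z + t * v - a‖) ^ n := by
      gcongr
      linarith
    have hk := mul_le_mul_of_nonneg_left hpow hκ0.le
    have h00 : p.eval (z + ((0 : ℝ) : ℂ) * v) - w - (1 - ((0 : ℝ) : ℂ)) * d = 0 := by
      simp [hd]
    rw [h00]
    simp only [zero_add, sub_zero, one_mul, norm_zero, zero_mul, add_zero]
    linarith)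
  have h1 : n * (1 - ρ) ^ (n - 1) * ‖v‖ ≤ ‖d‖ := by
    rw [← hvn, mul_comm ‖v‖]; gcongr
  nlinarith

theorem exists_eval_eq_of_norm_sub_le {p : ℂ[X]} (hp : p.Monic) (hdeg : 0 < p.natDegree) {a : ℂ}
    (hcrit : ∀ ζ : ℂ, p.derivative.eval ζ = 0 → 1 ≤ ‖ζ - a‖) {r : ℝ} (hr0 : 0 ≤ r) (hr1 : r < 1)
    {w : ℂ} (hw : ‖w - p.eval a‖ ≤ 1 - (1 - r) ^ p.natDegree) :
    ∃ z : ℂ, ‖z - a‖ ≤ r ∧ p.eval z = w := by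
  rcases hr0.eq_or_lt with rfl | hr
  · refine ⟨a, by simp, ?_⟩
    rw [sub_zero, one_pow, sub_self, norm_le_zero_iff, sub_eq_zero] at hw
    exact hw.symm
  have hG : 0 < 1 - (1 - r) ^ p.natDegree :=
    sub_pos.mpr (pow_lt_one₀ (by linarith) (by linarith) hdeg.ne')
  have hclosed : IsClosed ((fun z => p.eval z) '' Metric.closedBall a r) :=
    ((isCompact_closedBall a r).image p.continuous).isClosed
  have hsub : Metric.ball (p.eval a) (1 - (1 - r) ^ p.natDegree) ⊆
      (fun z => p.eval z) '' Metric.closedBall a r := fun y hy => by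
    obtain ⟨z, hz, hzy⟩ := exists_eval_eq_of_norm_sub_lt hp hdeg hcrit hr0 hr1
      (mem_ball_iff_norm.mp hy)
    exact ⟨z, mem_closedBall_iff_norm.mpr hz, hzy⟩
  have h := closure_minimal hsub hclosed
  rw [closure_ball _ hG.ne'] at h
  obtain ⟨z, hz, hzw⟩ := h (mem_closedBall_iff_norm.mpr hw)
  exact ⟨z, mem_closedBall_iff_norm.mp hz, hzw⟩

/-- If a polynomial takes the same value at two distinct points, then it has a critical point in
each of the closed half-planes bounded by the perpendicular bisector of these points. -/
theorem exists_eval_derivative_eq_zero_norm_sub_le {p : ℂ[X]} (hdeg : 0 < p.natDegree) {u v : ℂ}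
    (huv : u ≠ v) (h : p.eval u = p.eval v) :
    ∃ ζ : ℂ, p.derivative.eval ζ = 0 ∧ ‖ζ - v‖ ≤ ‖ζ - u‖ := by
  set c : ℂ := (v - u) / 2 with hc
  have hc0 : c ≠ 0 := div_ne_zero (sub_ne_zero.mpr huv.symm) two_ne_zero
  set l : ℂ[X] := C c * X + C ((u + v) / 2) with hl
  have hl1 : l.eval 1 = v := by simp [hl, hc]; ring
  have hl2 : l.eval (-1) = u := by simp [hl, hc]; ring
  obtain ⟨t, ht, hpt⟩ := exists_eval_derivative_eq_zero_of_eval_one_eq (P := p.comp l) hdeg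
    (natDegree_comp_le.trans (by
      have : l.natDegree ≤ 1 := by rw [hl]; compute_degree
      nlinarith))
    (by rw [eval_comp, eval_comp, hl1, hl2, h])
  have hld : l.derivative = C c := by simp [hl]
  rw [derivative_comp, eval_mul, hld, eval_C, eval_comp] at hpt
  refine ⟨l.eval t, (mul_eq_zero.mp hpt).resolve_left hc0, ?_⟩
  have e1 : l.eval t - v = c * (t - 1) := by simp [hl, hc]; ring
  have e2 : l.eval t - u = c * (t + 1) := by simp [hl, hc]; ring
  rw [e1, e2, norm_mul, norm_mul]
  gcongr
  rw [← sq_le_sq₀ (norm_nonneg _) (norm_nonneg _), ← Complex.normSq_eq_norm_sq,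
    ← Complex.normSq_eq_norm_sq, Complex.normSq_apply, Complex.normSq_apply]
  simp
  nlinarith

theorem norm_le_one_of_eval_derivative_eq_zero {p : ℂ[X]} (hdeg : 0 < p.natDegree)
    (hroot : ∀ z : ℂ, p.eval z = 0 → ‖z‖ ≤ 1) {ζ : ℂ} (hζ : p.derivative.eval ζ = 0) :
    ‖ζ‖ ≤ 1 := by
  have hsub : p.rootSet ℂ ⊆ Metric.closedBall 0 1 := fun z hz => by
    rw [mem_rootSet, coe_aeval_eq_eval] at hz
    simpa using hroot z hz.2
  have hd : p.derivative ≠ 0 := fun h0 => by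
    have := derivative_eq_zero.mp h0
    lia
  have hmem : ζ ∈ p.derivative.rootSet ℂ := by
    rw [mem_rootSet, coe_aeval_eq_eval]
    exact ⟨hd, hζ⟩
  have := convexHull_min hsub (convex_closedBall (0 : ℂ) 1)
    (rootSet_derivative_subset_convexHull_rootSet (natDegree_pos_iff_degree_pos.mp hdeg) hmem)
  simpa using this

theorem stmt_0 (n : ℕ) (hn : 2 ≤ n) (a : ℝ) (ha0 : 0 < a) (ha1 : a < 1)
    (z : ℕ → ℂ) (hz : ∀ k ∈ Finset.range (n - 1), ‖z k‖ ≤ 1)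
    (p : Polynomial ℂ)
    (hp : p = (X - C (a : ℂ)) * ∏ k ∈ Finset.range (n - 1), (X - C (z k)))
    (hρ : ∀ ζ : ℂ, p.derivative.eval ζ = 0 → 1 ≤ ‖ζ - (a : ℂ)‖)
    (lam : ℝ)
    (hlam1 : 1 - (1 - ‖p.eval 0‖) ^ ((1 : ℝ) / n) ≤ lam)
    (hlam2 : lam ≤ Real.sin (Real.pi / n)) (hlama : lam < a) :
    ∃ ζ₀ : ℂ, p.derivative.eval ζ₀ = 0 ∧
      (1 / 2) * (a - lam * (lam + 2) / a) ≤ ζ₀.re := by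
  have hn0 : n ≠ 0 := by lia
  have hmonic : p.Monic := by
    rw [hp]; exact (monic_X_sub_C _).mul (monic_prod_X_sub_C _ _)
  have hdeg : p.natDegree = n := by
    rw [hp, (monic_X_sub_C _).natDegree_mul (monic_prod_X_sub_C _ _), natDegree_X_sub_C,
      natDegree_finsetProd_X_sub_C_eq_card, Finset.card_range]
    lia
  have hpa : p.eval (a : ℂ) = 0 := by simp [hp]
  have hroot : ∀ w : ℂ, p.eval w = 0 → ‖w‖ ≤ 1 := fun w hw => by
    rw [hp, eval_mul, eval_prod, mul_eq_zero, Finset.prod_eq_zero_iff] at hw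
    rcases hw with hw | ⟨k, hk, hw⟩ <;>
      rw [eval_sub, eval_X, eval_C, sub_eq_zero] at hw <;> rw [hw]
    · rw [Complex.norm_of_nonneg ha0.le]; exact ha1.le
    · exact hz k hk
  have hp0 : ‖p.eval 0‖ < 1 := by
    rw [hp, eval_mul, eval_prod, norm_mul, norm_prod]
    simp only [eval_sub, eval_X, eval_C, zero_sub, norm_neg]
    have h1 : ∏ k ∈ Finset.range (n - 1), ‖z k‖ ≤ 1 :=
      Finset.prod_le_one (fun _ _ => norm_nonneg _) hz
    rw [Complex.norm_of_nonneg ha0.le]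
    nlinarith
  have hlam0 : 0 ≤ lam := by
    have : (1 - ‖p.eval 0‖) ^ ((1 : ℝ) / n) ≤ 1 :=
      Real.rpow_le_one (by linarith) (by linarith [norm_nonneg (p.eval 0)]) (by positivity)
    linarith
  have hval : ‖p.eval 0 - p.eval (a : ℂ)‖ ≤ 1 - (1 - lam) ^ p.natDegree := by
    rw [hpa, sub_zero, hdeg]
    have h1 : (1 - lam) ^ n ≤ ((1 - ‖p.eval 0‖) ^ ((1 : ℝ) / n)) ^ n := by
      gcongr
      · linarith
      · linarith
    rw [one_div, Real.rpow_inv_natCast_pow (by linarith) hn0] at h1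
    linarith
  obtain ⟨w, hwa, hw⟩ := exists_eval_eq_of_norm_sub_le hmonic (by lia) hρ hlam0
    (hlama.trans ha1) hval
  have hw0 : (0 : ℂ) ≠ w := by
    rintro rfl
    rw [zero_sub, norm_neg, Complex.norm_of_nonneg ha0.le] at hwa
    linarith
  obtain ⟨ζ, hζ, hζw⟩ := exists_eval_derivative_eq_zero_norm_sub_le (by lia) hw0 hw.symm
  refine ⟨ζ, hζ, ?_⟩
  rw [sub_zero] at hζw
  have hζ1 := norm_le_one_of_eval_derivative_eq_zero (by lia) hroot hζ
  have h1 : ‖ζ - a‖ ≤ ‖ζ‖ + lam := by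
    linarith [norm_sub_le_norm_sub_add_norm_sub ζ w a]
  have h2 : ‖ζ - a‖ ^ 2 ≤ ‖ζ‖ ^ 2 + lam * (lam + 2) := by
    nlinarith [norm_nonneg (ζ - a), norm_nonneg ζ]
  rw [← Complex.normSq_eq_norm_sq, ← Complex.normSq_eq_norm_sq, Complex.normSq_apply,
    Complex.normSq_apply] at h2
  simp at h2
  have h3 : a - lam * (lam + 2) / a ≤ 2 * ζ.re := by
    rw [sub_le_iff_le_add', ← sub_le_iff_le_add, le_div_iff₀ ha0]
    nlinarith
  linarith
end

section
/- Let n ≥ 2, let a ∈ (0,1), and let p(z) = (z−a)·∏_{k=1}^{n−1}(z−z_k) with |z_k| ≤ 1 for all k. Suppose every zero ζ of p′ satisfies |ζ − a| ≥ 1, and let λ be a real number with 0 < λ ≤ sin(π/n). Then p is injective on the closed disk {z : |z − a| ≤ λ}. -/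
open Polynomial Real Complex

lemma one_sub_re_sub_normSq_eq {x s w : ℂ} (h : w * (x - s) = 1) :
    1 - 2 * (x * w).re - (1 - normSq x) * normSq w = (normSq s - 1) * normSq w := by
  have h1 : s * w = x * w - 1 := by linear_combination -h
  have h2 := congrArg normSq h1
  rw [normSq_mul, normSq_sub, normSq_mul, map_one, map_one, mul_one] at h2
  linarith

lemma eval_eq_zero_of_polar_eval_eq_zero {q : ℂ[X]} {N : ℕ} (hN : N ≠ 0)
    (hdeg : q.natDegree ≤ N) (hq : ∀ s, q.eval s = 0 → 1 ≤ ‖s‖) {t x : ℂ}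
    (ht : ‖t‖ < 1) (hx : ‖x‖ ≤ 1)
    (h : N * q.eval x + (t - x) * q.derivative.eval x = 0) : q.eval x = 0 := by
  by_contra hqx
  have hNC : (N : ℂ) ≠ 0 := by exact_mod_cast hN
  have hxt : x - t ≠ 0 := by
    intro hxt
    have : t - x = 0 := by linear_combination -hxt
    simp [this, hNC, hqx] at h
  obtain ⟨W, hW⟩ : ∃ W, W = (x - t)⁻¹ := ⟨_, rfl⟩
  have hWt : W * (x - t) = 1 := by rw [hW, inv_mul_cancel₀ hxt]
  have hW0 : W ≠ 0 := by rw [hW]; exact inv_ne_zero hxt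
  have hβ : 0 ≤ 1 - normSq x := by
    rw [normSq_eq_norm_sq]; nlinarith [norm_nonneg x]
  have hφW : 1 - 2 * (x * W).re - (1 - normSq x) * normSq W < 0 := by
    rw [one_sub_re_sub_normSq_eq hWt]
    refine mul_neg_of_neg_of_pos ?_ (normSq_pos.2 hW0)
    rw [normSq_eq_norm_sq]; nlinarith [norm_nonneg t]
  obtain ⟨γ, hγ⟩ : ∃ γ, γ = x + ((1 - normSq x : ℝ) : ℂ) * (starRingEnd ℂ) W := ⟨_, rfl⟩
  obtain ⟨A, hA⟩ : ∃ A, A = 1 + (1 - normSq x) * normSq W := ⟨_, rfl⟩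
  have hA0 : 0 ≤ A := by have := mul_nonneg hβ (normSq_nonneg W); linarith
  have hγre (w : ℂ) : (γ * w).re = (x * w).re +
      (1 - normSq x) * (W.re * w.re + W.im * w.im) := by
    rw [hγ, add_mul, add_re, mul_assoc, re_ofReal_mul]
    simp [mul_re]
  have hγW : A - 2 * (γ * W).re < 0 := by
    rw [hγre, hA]
    simp only [normSq_apply W] at *
    nlinarith
  have hroot (s : ℂ) (hs : s ∈ q.roots) : 2 * (γ * (1 / (x - s))).re ≤ A := by
    have hs0 : q.eval s = 0 := (mem_roots'.1 hs).2
    have hxs : x - s ≠ 0 := by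
      intro hxs
      exact hqx (by rw [sub_eq_zero.1 hxs, hs0])
    obtain ⟨w, hw⟩ : ∃ w, w = 1 / (x - s) := ⟨_, rfl⟩
    rw [← hw]
    have hφ : 0 ≤ 1 - 2 * (x * w).re - (1 - normSq x) * normSq w := by
      rw [one_sub_re_sub_normSq_eq (s := s) (by rw [hw]; field_simp)]
      refine mul_nonneg ?_ (normSq_nonneg w)
      rw [normSq_eq_norm_sq]; nlinarith [hq s hs0]
    have hsq := mul_nonneg hβ (normSq_nonneg (w - W))
    rw [hγre, hA]
    rw [normSq_apply w] at hφ
    rw [normSq_apply W]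
    rw [normSq_apply (w - W), sub_re, sub_im] at hsq
    nlinarith
  have hsum := (IsAlgClosed.splits q).eval_derivative_eq_eval_mul_sum hqx
  obtain ⟨S, hS⟩ : ∃ S, S = (q.roots.map fun z ↦ 1 / (x - z)).sum := ⟨_, rfl⟩
  rw [← hS] at hsum
  have hSW : S = N * W := by
    rw [hsum] at h
    have : (x - t) * S = N := by
      apply mul_left_cancel₀ hqx
      linear_combination -h
    rw [← this]; linear_combination (-S) * hWt
  have hre (m : Multiset ℂ) (hm : ∀ s ∈ m, 2 * (γ * (1 / (x - s))).re ≤ A) :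
      2 * (γ * (m.map fun z ↦ 1 / (x - z)).sum).re ≤ m.card * A := by
    induction m using Multiset.induction_on with
    | empty => simp
    | cons s m ih =>
      have h1 := hm s (Multiset.mem_cons_self s m)
      have h2 := ih fun r hr ↦ hm r (Multiset.mem_cons_of_mem hr)
      rw [Multiset.map_cons, Multiset.sum_cons, mul_add, add_re, Multiset.card_cons]
      push_cast
      linarith
  have h1 := hre q.roots hroot
  rw [← hS, hSW, show γ * (N * W) = ((N : ℝ) : ℂ) * (γ * W) by push_cast; ring,
    re_ofReal_mul] at h1
  have h2 : (q.roots.card : ℝ) ≤ N := by exact_mod_cast (card_roots' q).trans hdeg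
  have h3 : (0 : ℝ) < N := by positivity
  nlinarith

/-- Iterated polar derivatives of a polynomial of degree at most `l.length + 1`, at the points
of `l` and finally at `t`. -/
noncomputable def polar (t : ℂ) : List ℂ → ℂ[X] →ₗ[ℂ] ℂ
  | [] => leval t
  | s :: l => polar t l ∘ₗ
      (((l.length : ℂ) + 2) • LinearMap.id + LinearMap.mulLeft ℂ (C s - X) ∘ₗ derivative)

lemma polar_cons_apply (t s : ℂ) (l : List ℂ) (q : ℂ[X]) :
    polar t (s :: l) q =
      polar t l (C ((l.length : ℂ) + 2) * q + (C s - X) * derivative q) := by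
  simp [polar, smul_eq_C_mul]

lemma polar_X_sub_C_pow (t r : ℂ) (l : List ℂ) :
    polar t l ((X - C r) ^ (l.length + 1)) =
      (l.length + 1).factorial * ((l.map (· - r)).prod * (t - r)) := by
  induction l with
  | nil => simp [polar]
  | cons s l ih =>
    have h : C ((l.length : ℂ) + 2) * (X - C r) ^ (l.length + 1 + 1) +
        (C s - X) * derivative ((X - C r) ^ (l.length + 1 + 1)) =
        (((l.length : ℂ) + 2) * (s - r)) • (X - C r) ^ (l.length + 1) := by
      rw [derivative_X_sub_C_pow, smul_eq_C_mul]
      simp only [map_add, map_mul, map_sub, map_natCast, map_ofNat, Nat.add_sub_cancel]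
      push_cast
      ring
    rw [polar_cons_apply, List.length_cons, h, map_smul, ih, List.map_cons, List.prod_cons,
      Nat.factorial_succ (l.length + 1), smul_eq_mul]
    push_cast
    ring

lemma natDegree_polar_le {q : ℂ[X]} {N : ℕ} (hdeg : q.natDegree ≤ N + 1) (s : ℂ) :
    (C ((N : ℂ) + 1) * q + (C s - X) * derivative q).natDegree ≤ N := by
  rw [natDegree_le_iff_coeff_eq_zero]
  intro k hk
  have hq (j : ℕ) (hj : N + 1 < j) : q.coeff j = 0 :=
    coeff_eq_zero_of_natDegree_lt (hdeg.trans_lt hj)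
  obtain ⟨k, rfl⟩ : ∃ j, k = j + 1 := ⟨k - 1, by omega⟩
  rw [sub_mul, coeff_add, coeff_sub, coeff_C_mul, coeff_C_mul, coeff_X_mul, coeff_derivative,
    coeff_derivative, hq (k + 1 + 1) (by omega)]
  rcases Nat.lt_or_ge N k with h | h
  · rw [hq (k + 1) (by omega)]; ring
  · obtain rfl : k = N := by omega
    ring

lemma X_sub_C_pow_dvd_of_polar_eq_zero {t : ℂ} (ht : ‖t‖ ≤ 1) (l : List ℂ)
    (hl : ∀ s ∈ l, ‖s‖ < 1) {q : ℂ[X]} (hdeg : q.natDegree ≤ l.length + 1)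
    (hq : ∀ s, q.eval s = 0 → 1 ≤ ‖s‖) (h : polar t l q = 0) :
    (X - C t) ^ (l.length + 1) ∣ q := by
  induction l generalizing q with
  | nil => simpa [polar, dvd_iff_isRoot] using h
  | cons s l ih =>
    rw [polar_cons_apply] at h
    have hs := hl s List.mem_cons_self
    have hcast : (l.length : ℂ) + 2 = ((l.length + 1 : ℕ) : ℂ) + 1 := by push_cast; ring
    have key (x : ℂ) (hx : ‖x‖ ≤ 1)
        (h0 : (C ((l.length : ℂ) + 2) * q + (C s - X) * derivative q).eval x = 0) :
        q.eval x = 0 := by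
      refine eval_eq_zero_of_polar_eval_eq_zero (N := l.length + 2) (by omega) hdeg hq hs hx ?_
      simpa using h0
    have hdvd := ih (fun r hr ↦ hl r (List.mem_cons_of_mem s hr))
      (by rw [hcast]; exact natDegree_polar_le hdeg s)
      (fun x h0 ↦ by
        by_contra! hx
        exact hx.not_ge (hq x (key x hx.le h0))) h
    have hqt : q.eval t = 0 := by
      refine key t ht (dvd_iff_isRoot.1 ((dvd_pow_self _ (by omega)).trans hdvd))
    have hq0 : q ≠ 0 := by
      rintro rfl
      exact absurd (hq 0 (by simp)) (by simp)
    have hst : s - t ≠ 0 := by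
      intro hst
      rw [sub_eq_zero.1 hst] at hs
      exact hs.not_ge (hq t hqt)
    obtain ⟨g, hg, hgt⟩ := exists_eq_pow_rootMultiplicity_mul_and_not_dvd q hq0 t
    have hm : 0 < q.rootMultiplicity t := (rootMultiplicity_pos hq0).2 hqt
    rw [List.length_cons, ← le_rootMultiplicity_iff hq0]
    obtain ⟨k, hk⟩ : ∃ k, q.rootMultiplicity t = k + 1 := ⟨_, (Nat.succ_pred_eq_of_pos hm).symm⟩
    rw [hk] at hg ⊢
    by_contra! hlt
    have hdvd' : (X - C t) ^ k * (X - C t) ∣ (X - C t) ^ k *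
        ((X - C t) * (C ((l.length : ℂ) + 2) * g) +
          (C s - X) * (C ((k : ℂ) + 1) * g + (X - C t) * derivative g)) := by
      rw [← pow_succ]
      refine ((pow_dvd_pow _ (by omega)).trans hdvd).trans (dvd_of_eq ?_)
      rw [hg, derivative_mul, derivative_X_sub_C_pow, Nat.add_sub_cancel]
      push_cast
      ring
    have hgt0 := dvd_iff_isRoot.1
      ((mul_dvd_mul_iff_left (pow_ne_zero k (X_sub_C_ne_zero t))).1 hdvd')
    have hk0 : (k : ℂ) + 1 ≠ 0 := by exact_mod_cast k.succ_ne_zero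
    simp only [IsRoot, eval_add, eval_mul, eval_sub, eval_X, eval_C, sub_self, zero_mul, zero_add,
      add_zero, mul_eq_zero, hst, hk0, false_or] at hgt0
    exact hgt (dvd_iff_isRoot.2 hgt0)

lemma linearMap_eq_zero_of_X_sub_C_pow (F : ℂ[X] →ₗ[ℂ] ℂ) (n : ℕ)
    (hF : ∀ r, F ((X - C r) ^ n) = 0) {q : ℂ[X]} (hq : q.natDegree ≤ n) : F q = 0 := by
  have hzero : ∑ k ∈ Finset.range (n + 1), C (F (X ^ (n - k)) * n.choose k) * X ^ k = 0 := by
    refine Polynomial.funext fun r ↦ ?_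
    have h := hF (-r)
    rw [C_neg, sub_neg_eq_add, add_comm, add_pow, map_sum] at h
    rw [eval_finsetSum, eval_zero, ← h]
    refine Finset.sum_congr rfl fun k _ ↦ ?_
    rw [show C r ^ k * X ^ (n - k) * (n.choose k : ℂ[X]) =
        (r ^ k * (n.choose k : ℂ)) • X ^ (n - k) by
      rw [smul_eq_C_mul, C_mul, C_pow, map_natCast]; ring, map_smul]
    simp only [eval_mul, eval_C, eval_pow, eval_X, smul_eq_mul]
    ring
  have hX (k : ℕ) (hk : k ≤ n) : F (X ^ k) = 0 := by
    have h := congrArg (fun p ↦ coeff p (n - k)) hzero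
    simp only [finsetSum_coeff, coeff_C_mul_X_pow, coeff_zero] at h
    rw [Finset.sum_ite_eq, if_pos (by simp), Nat.sub_sub_self hk] at h
    refine (mul_eq_zero.1 h).resolve_right ?_
    exact_mod_cast (Nat.choose_pos (Nat.sub_le n k)).ne'
  rw [q.as_sum_range_C_mul_X_pow' (Nat.lt_succ_of_le hq), map_sum]
  refine Finset.sum_eq_zero fun k hk ↦ ?_
  rw [← smul_eq_C_mul, map_smul, hX k (by simpa [Nat.lt_succ_iff] using hk), smul_zero]

lemma two_mul_sin_le_norm_one_sub {n : ℕ} {ω : ℂ} (hn : 2 ≤ n) (hω : ω ^ n = 1) (hω1 : ω ≠ 1) :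
    2 * Real.sin (π / n) ≤ ‖1 - ω‖ := by
  have : NeZero n := ⟨by omega⟩
  obtain ⟨k, hk, rfl⟩ := (Complex.isPrimitiveRoot_exp n (by omega)).eq_pow_of_pow_eq_one hω
  have hk0 : k ≠ 0 := by rintro rfl; simp at hω1
  have hn0 : (0 : ℝ) < n := by positivity
  have hk1 : (1 : ℝ) ≤ k := by exact_mod_cast Nat.one_le_iff_ne_zero.2 hk0
  have hk2 : (k : ℝ) + 1 ≤ n := by exact_mod_cast hk
  have hsin : Real.sin (π / n) ≤ Real.sin (π * k / n) := by
    have hpos := div_pos Real.pi_pos hn0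
    have hn' : π = π / n * n := by field_simp
    obtain ⟨c, hc⟩ : ∃ c, c = π / n := ⟨_, rfl⟩
    rw [mul_div_right_comm, ← hc]
    rw [← hc] at hpos hn'
    rcases le_total (c * k) (π / 2) with h | h
    · exact Real.sin_le_sin_of_le_of_le_pi_div_two (by linarith [Real.pi_pos]) h (by nlinarith)
    · rw [← Real.sin_pi_sub (c * k)]
      exact Real.sin_le_sin_of_le_of_le_pi_div_two (by linarith [Real.pi_pos]) (by linarith)
        (by nlinarith)
  rw [norm_sub_rev, ← Complex.exp_nat_mul,
    show (k : ℂ) * (2 * π * I / n) = I * ((2 * (π * k / n) : ℝ) : ℂ) by push_cast; ring,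
    Complex.norm_exp_I_mul_ofReal_sub_one, Real.norm_eq_abs, mul_div_cancel_left₀ _ two_ne_zero]
  exact le_trans (by linarith) (le_abs_self _)

lemma add_mul_eq_zero_of_two_mul_le_norm_sub {u v ω : ℂ} {s : ℝ} (hω : ‖ω‖ = 1) (hs : 0 ≤ s)
    (hu : ‖u‖ ≤ s) (hv : ‖v‖ ≤ s) (h : 2 * s ≤ ‖v - ω * u‖) : v + ω * u = 0 := by
  have hpar := parallelogram_law_with_norm ℝ v (ω * u)
  rw [norm_mul, hω, one_mul] at hpar
  rw [← norm_le_zero_iff]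
  nlinarith [norm_nonneg (v + ω * u), norm_nonneg u, norm_nonneg v]

lemma exists_pow_dvd_derivative_of_eval_eq {n : ℕ} (hn : 2 ≤ n) {p : ℂ[X]}
    (hdeg : p.natDegree ≤ n) (hroot : ∀ ζ, p.derivative.eval ζ = 0 → 1 ≤ ‖ζ‖) {u v : ℂ}
    (hu : ‖u‖ ≤ Real.sin (π / n)) (hv : ‖v‖ ≤ Real.sin (π / n)) (huv : u ≠ v)
    (heval : p.eval u = p.eval v) : ∃ b, (X - C b) ^ (n - 1) ∣ p.derivative := by
  classical
  have hprim := Complex.isPrimitiveRoot_exp n (by omega)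
  have hn2 : (2 : ℝ) ≤ n := by exact_mod_cast hn
  have hs0 : 0 < Real.sin (π / n) :=
    Real.sin_pos_of_pos_of_lt_pi (by positivity)
      (by rw [div_lt_iff₀ (by positivity)]; nlinarith [Real.pi_pos])
  obtain ⟨R, hR⟩ : ∃ R, R = (nthRootsFinset n (1 : ℂ)).erase 1 := ⟨_, rfl⟩
  have hone : (1 : ℂ) ∈ nthRootsFinset n (1 : ℂ) := (mem_nthRootsFinset (by omega) 1).2 (one_pow n)
  have hRcard : R.card = n - 1 := by
    rw [hR, Finset.card_erase_of_mem hone, hprim.card_nthRootsFinset]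
  have hRpow (ω : ℂ) (hω : ω ∈ R) : ω ^ n = 1 := by
    rw [hR] at hω
    exact (mem_nthRootsFinset (by omega) 1).1 (Finset.mem_of_mem_erase hω)
  have hR1 (ω : ℂ) (hω : ω ∈ R) : 1 - ω ≠ 0 := by
    rw [hR] at hω
    exact sub_ne_zero.2 (Finset.ne_of_mem_erase hω).symm
  have hRnorm (ω : ℂ) (hω : ω ∈ R) : ‖ω‖ = 1 :=
    Complex.norm_eq_one_of_pow_eq_one (hRpow ω hω) (by omega)
  have hR2 (ω : ℂ) (hω : ω ∈ R) : 2 * Real.sin (π / n) ≤ ‖1 - ω‖ :=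
    two_mul_sin_le_norm_one_sub hn (hRpow ω hω) fun h ↦ hR1 ω hω (by rw [h, sub_self])
  obtain ⟨τ, hτ⟩ : ∃ τ : ℂ → ℂ, τ = fun ω ↦ (v - ω * u) / (1 - ω) := ⟨_, rfl⟩
  have hτle (ω : ℂ) (hω : ω ∈ R) : ‖τ ω‖ ≤ 1 := by
    rw [hτ, norm_div]
    refine div_le_one_of_le₀ ?_ (norm_nonneg _)
    have h1 := norm_sub_le v (ω * u)
    rw [norm_mul, hRnorm ω hω] at h1
    linarith [hR2 ω hω]
  have hτeq (ω : ℂ) (hω : ω ∈ R) (h : 1 ≤ ‖τ ω‖) : v + ω * u = 0 := by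
    rw [hτ, norm_div, one_le_div₀ (norm_pos_iff.2 (hR1 ω hω))] at h
    exact add_mul_eq_zero_of_two_mul_le_norm_sub (hRnorm ω hω) hs0.le hu hv ((hR2 ω hω).trans h)
  obtain ⟨ω₀, hω₀, hlt⟩ : ∃ ω₀ ∈ R, ∀ ω ∈ R.erase ω₀, ‖τ ω‖ < 1 := by
    by_cases hex : ∃ ω₀ ∈ R, 1 ≤ ‖τ ω₀‖
    · obtain ⟨ω₀, hω₀, h₀⟩ := hex
      refine ⟨ω₀, hω₀, fun ω hω ↦ ?_⟩
      by_contra! h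
      have e₀ := hτeq ω₀ hω₀ h₀
      have e := hτeq ω (Finset.mem_of_mem_erase hω) h
      have hu0 : u = 0 := by
        have : (ω - ω₀) * u = 0 := by linear_combination e - e₀
        exact (mul_eq_zero.1 this).resolve_left (sub_ne_zero.2 (Finset.ne_of_mem_erase hω))
      rw [hu0, mul_zero, add_zero] at e
      exact huv (hu0.trans e.symm)
    · push Not at hex
      obtain ⟨ω₀, hω₀⟩ := Finset.card_pos.1 (by omega : 0 < R.card)
      exact ⟨ω₀, hω₀, fun ω hω ↦ hex ω (Finset.mem_of_mem_erase hω)⟩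
  obtain ⟨l, hl⟩ : ∃ l, l = (R.erase ω₀).toList.map τ := ⟨_, rfl⟩
  have hlen : l.length + 1 = n - 1 := by
    rw [hl, List.length_map, Finset.length_toList, Finset.card_erase_of_mem hω₀]
    omega
  have hprod (r : ℂ) : (v - r) ^ n - (u - r) ^ n =
      (v - u) * (∏ ω ∈ R, (1 - ω)) * ((l.map (· - r)).prod * (τ ω₀ - r)) := by
    rw [hprim.pow_sub_pow_eq_prod_sub_mul _ _ (by omega), ← Finset.mul_prod_erase _ _ hone, ← hR,
      hl, List.map_map, Finset.prod_map_toList, mul_comm (∏ ω ∈ R.erase ω₀, _), mul_assoc,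
      show τ ω₀ - r = (fun ω ↦ τ ω - r) ω₀ from rfl]
    simp only [Function.comp_def]
    rw [Finset.mul_prod_erase R (fun ω ↦ τ ω - r) hω₀, ← Finset.prod_mul_distrib]
    congr 1
    · ring
    · refine Finset.prod_congr rfl fun ω hω ↦ ?_
      have := hR1 ω hω
      rw [hτ]
      field_simp
      ring
  obtain ⟨K, hK⟩ : ∃ K, K = (v - u) * ∏ ω ∈ R, (1 - ω) := ⟨_, rfl⟩
  have hK0 : K ≠ 0 := by
    rw [hK]
    exact mul_ne_zero (sub_ne_zero.2 huv.symm) (Finset.prod_ne_zero_iff.2 hR1)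
  have hfac : (n.factorial : ℂ) ≠ 0 := by exact_mod_cast n.factorial_ne_zero
  have happly := linearMap_eq_zero_of_X_sub_C_pow
    ((n.factorial : ℂ) • (leval v - leval u) - K • polar (τ ω₀) l ∘ₗ derivative) n (fun r ↦ by
      have hpolar := polar_X_sub_C_pow (τ ω₀) r l
      have hder : derivative ((X - C r) ^ n) = (n : ℂ) • (X - C r) ^ (l.length + 1) := by
        rw [derivative_X_sub_C_pow, hlen, smul_eq_C_mul, map_natCast]
      have hnfac : (n.factorial : ℂ) = n * (l.length + 1).factorial := by
        rw [hlen]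
        exact_mod_cast (Nat.mul_factorial_pred (by omega)).symm
      simp only [LinearMap.sub_apply, LinearMap.smul_apply, LinearMap.comp_apply, hder, map_smul,
        hpolar, leval_apply, eval_pow, eval_sub, eval_X, eval_C, hprod, smul_eq_mul, ← hK, hnfac]
      ring) hdeg
  simp only [LinearMap.sub_apply, LinearMap.smul_apply, LinearMap.comp_apply, leval_apply, heval,
    sub_self, mul_zero, zero_sub, neg_eq_zero, smul_eq_mul, mul_eq_zero, hK0, false_or] at happly
  refine ⟨τ ω₀, hlen ▸ X_sub_C_pow_dvd_of_polar_eq_zero (hτle ω₀ hω₀) l ?_ ?_ hroot happly⟩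
  · intro s hs
    rw [hl, List.mem_map] at hs
    obtain ⟨ω, hω, rfl⟩ := hs
    exact hlt ω (Finset.mem_toList.1 hω)
  · exact (natDegree_derivative_le p).trans (by omega)

lemma eval_eq_of_pow_dvd_derivative {n : ℕ} (hn : n ≠ 0) {p : ℂ[X]} (hdeg : p.natDegree ≤ n)
    {b : ℂ} (hdvd : (X - C b) ^ (n - 1) ∣ p.derivative) {ω : ℂ} (hω : ω ^ n = 1) (x : ℂ) :
    p.eval (b + ω * (x - b)) = p.eval x := by
  obtain ⟨c, hc⟩ : ∃ c, p.derivative = C c * (X - C b) ^ (n - 1) := by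
    obtain ⟨g, hg⟩ := hdvd
    rcases eq_or_ne g 0 with rfl | hg0
    · exact ⟨0, by simp [hg]⟩
    have h := natDegree_derivative_le p
    rw [hg, natDegree_mul (pow_ne_zero _ (X_sub_C_ne_zero b)) hg0, natDegree_pow,
      natDegree_X_sub_C] at h
    exact ⟨g.coeff 0, by rw [hg, eq_C_of_natDegree_eq_zero (p := g) (by omega)]; simp [mul_comm]⟩
  have hn0 : (n : ℂ) ≠ 0 := by exact_mod_cast hn
  have hder : derivative (p - C (c / n) * (X - C b) ^ n) = 0 := by
    rw [derivative_sub, derivative_C_mul, derivative_X_sub_C_pow, hc, ← mul_assoc, ← C_mul, div_mul_cancel₀ _ hn0, sub_self]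
  have hp := eq_C_of_natDegree_eq_zero (derivative_eq_zero.1 hder)
  rw [sub_eq_iff_eq_add] at hp
  rw [hp]
  simp [mul_pow, hω]

lemma sum_normSq_add_mul_nthRoots {n : ℕ} (hn : 2 ≤ n) (b c : ℂ) :
    ∑ ω ∈ nthRootsFinset n (1 : ℂ), normSq (b + ω * c) = n * (normSq b + normSq c) := by
  have hprim := Complex.isPrimitiveRoot_exp n (by omega)
  have hsum : ∑ ω ∈ nthRootsFinset n (1 : ℂ), ω = 0 := by
    obtain ⟨ζ, hζ⟩ : ∃ ζ : ℂ, IsPrimitiveRoot ζ n := ⟨_, hprim⟩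
    have hζ0 : ζ ≠ 0 := hζ.ne_zero (by omega)
    have hmul : ∑ ω ∈ nthRootsFinset n (1 : ℂ), ζ * ω = ∑ ω ∈ nthRootsFinset n (1 : ℂ), ω :=
      Finset.sum_nbij' (ζ * ·) (ζ⁻¹ * ·)
        (by simp +contextual [mem_nthRootsFinset (by omega : 0 < n), mul_pow, hζ.pow_eq_one])
        (by simp +contextual [mem_nthRootsFinset (by omega : 0 < n), mul_pow, hζ.pow_eq_one])
        (by simp [hζ0]) (by simp [hζ0]) (by simp)
    rw [← Finset.mul_sum] at hmul
    have h : (ζ - 1) * ∑ ω ∈ nthRootsFinset n (1 : ℂ), ω = 0 := by linear_combination hmul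
    exact (mul_eq_zero.1 h).resolve_left (sub_ne_zero.2 (hζ.ne_one (by omega)))
  have hterm (ω : ℂ) (hω : ω ∈ nthRootsFinset n (1 : ℂ)) : normSq (b + ω * c) =
      normSq b + normSq c + 2 * (ω * (c * (starRingEnd ℂ) b)).re := by
    have h1 := Complex.norm_eq_one_of_pow_eq_one
      ((mem_nthRootsFinset (by omega) 1).1 hω) (by omega)
    rw [add_comm b, normSq_add, normSq_mul, normSq_eq_norm_sq ω, h1, mul_assoc]
    ring
  rw [Finset.sum_congr rfl hterm, Finset.sum_add_distrib, ← Finset.mul_sum, ← Complex.re_sum,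
    ← Finset.sum_mul, hsum, Finset.sum_const, hprim.card_nthRootsFinset]
  simp [mul_add]

theorem stmt_3 (n : ℕ) (hn : 2 ≤ n) (a : ℝ) (ha0 : 0 < a) (ha1 : a < 1)
    (z : ℕ → ℂ) (hz : ∀ k ∈ Finset.range (n - 1), ‖z k‖ ≤ 1)
    (p : Polynomial ℂ)
    (hp : p = (X - C (a : ℂ)) * ∏ k ∈ Finset.range (n - 1), (X - C (z k)))
    (hρ : ∀ ζ : ℂ, p.derivative.eval ζ = 0 → 1 ≤ ‖ζ - (a : ℂ)‖)
    (lam : ℝ) (hlam0 : 0 < lam) (hlam : lam ≤ Real.sin (Real.pi / n)) :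
    Set.InjOn (fun w => p.eval w) (Metric.closedBall (a : ℂ) lam) := by
  intro u hu v hv huv
  by_contra hne
  rw [Metric.mem_closedBall, dist_eq_norm] at hu hv
  have hpa : p.eval (a : ℂ) = 0 := by simp [hp]
  have hroots (w : ℂ) (hw : p.eval w = 0) : ‖w‖ ≤ 1 := by
    rw [hp, eval_mul, eval_prod, mul_eq_zero, Finset.prod_eq_zero_iff] at hw
    simp only [eval_sub, eval_X, eval_C, sub_eq_zero] at hw
    rcases hw with rfl | ⟨k, hk, rfl⟩
    · rw [Complex.norm_of_nonneg ha0.le]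
      exact ha1.le
    · exact hz k hk
  have hdeg : p.natDegree = n := by
    rw [hp, natDegree_mul (X_sub_C_ne_zero _)
      (Finset.prod_ne_zero_iff.2 fun k _ ↦ X_sub_C_ne_zero _),
      natDegree_prod _ _ fun k _ ↦ X_sub_C_ne_zero _]
    simp
    omega
  have hPdeg : (p.comp (X + C (a : ℂ))).natDegree ≤ n := by
    rw [natDegree_comp, natDegree_X_add_C, hdeg, mul_one]
  have hPder : derivative (p.comp (X + C (a : ℂ))) = p.derivative.comp (X + C (a : ℂ)) := by
    simp [derivative_comp]
  obtain ⟨b, hb⟩ := exists_pow_dvd_derivative_of_eval_eq hn hPdeg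
    (fun ζ hζ ↦ by simpa using hρ (ζ + a) (by simpa [hPder] using hζ))
    (hu.trans hlam) (hv.trans hlam) (fun h ↦ hne (sub_left_inj.1 h)) (by simpa using huv)
  have hb1 : 1 ≤ ‖b‖ := by
    have h := dvd_iff_isRoot.1 ((dvd_pow_self _ (by omega)).trans hb)
    simpa using hρ (b + a) (by simpa [hPder] using h)
  have hle (ω : ℂ) (hω : ω ∈ nthRootsFinset n (1 : ℂ)) : normSq ((b + a) + ω * (-b)) ≤ 1 := by
    have h := eval_eq_of_pow_dvd_derivative (by omega) hPdeg hb
      ((mem_nthRootsFinset (by omega) 1).1 hω) 0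
    simp only [eval_comp, eval_add, eval_X, eval_C, zero_add, hpa, zero_sub] at h
    have h1 := hroots _ h
    rw [normSq_eq_norm_sq, add_right_comm]
    nlinarith [norm_nonneg (b + ω * -b + a)]
  have hsum := Finset.sum_le_card_nsmul _ _ 1 hle
  rw [sum_normSq_add_mul_nthRoots hn,
    (Complex.isPrimitiveRoot_exp n (by omega)).card_nthRootsFinset, nsmul_eq_mul] at hsum
  have hsum' := le_of_mul_le_mul_left hsum (by positivity)
  rw [normSq_eq_norm_sq (-b), norm_neg] at hsum'
  have hba : b + a = 0 := by
    rw [← normSq_eq_zero]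
    nlinarith [normSq_nonneg (b + a)]
  rw [eq_neg_of_add_eq_zero_left hba, norm_neg, Complex.norm_of_nonneg ha0.le] at hb1
  exact hb1.not_gt ha1
end

section
/- Let n ≥ 2, let a ∈ (0,1), and let p(z) = (z−a)·∏_{k=1}^{n−1}(z−z_k) with |z_k| ≤ 1 for all k. Suppose every zero ζ of p′ satisfies |ζ − a| ≥ 1, and let λ be a real number with 1 − (1 − |p(0)|)^{1/n} ≤ λ ≤ sin(π/n) and 0 < λ. Then there exists a unique complex number z₀ with |z₀ − a| ≤ λ such that p(z₀) = p(0). -/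
open Polynomial Real Complex

/-- The values of `x` for which `b - x⁻¹` lies outside the closed unit disc (and `x = 0`). -/
def inverseExterior (b : ℂ) : Set ℂ :=
  {x | 2 * (b * x).re + (1 - ‖b‖ ^ 2) * ‖x‖ ^ 2 < 1}

lemma convex_inverseExterior {b : ℂ} (hb : ‖b‖ ≤ 1) : Convex ℝ (inverseExterior b) := by
  have h1 : ConvexOn ℝ Set.univ fun x : ℂ => 2 * (b * x).re := by
    refine ⟨convex_univ, fun x _ y _ s t _ _ _ => le_of_eq ?_⟩
    simp
    ring
  have h2 : ConvexOn ℝ Set.univ fun x : ℂ => (1 - ‖b‖ ^ 2) * ‖x‖ ^ 2 :=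
    (convexOn_univ_norm.pow (fun x _ => norm_nonneg x) 2).smul
      (by nlinarith [norm_nonneg b])
  simpa [inverseExterior] using (h1.add h2).convex_lt 1

lemma mem_inverseExterior_iff {b x : ℂ} (hx : x ≠ 0) :
    x ∈ inverseExterior b ↔ 1 < ‖b - x⁻¹‖ := by
  have h1 : ‖b - x⁻¹‖ * ‖x‖ = ‖b * x - 1‖ := by
    rw [← norm_mul, sub_mul, inv_mul_cancel₀ hx]
  have h2 : ‖b * x - 1‖ ^ 2 = ‖b‖ ^ 2 * ‖x‖ ^ 2 - 2 * (b * x).re + 1 := by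
    rw [← mul_pow, ← norm_mul, Complex.sq_norm, Complex.sq_norm, normSq_apply, normSq_apply]
    simp
    ring
  have hx0 : 0 < ‖x‖ := norm_pos_iff.2 hx
  have h3 : 1 < ‖b - x⁻¹‖ ↔ ‖x‖ ^ 2 < ‖b * x - 1‖ ^ 2 := by
    rw [← h1, sq_lt_sq₀ (by positivity) (by positivity)]
    exact (lt_mul_iff_one_lt_left hx0).symm
  rw [h3, h2]
  simp only [inverseExterior, Set.mem_ofPred_eq]
  constructor <;> intro h <;> linarith

lemma Convex.exists_multiset_sum_eq {D : Set ℂ} (hD : Convex ℝ D) (h0 : (0 : ℂ) ∈ D)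
    (S : Multiset ℂ) (hS : ∀ x ∈ S, x ∈ D) : ∃ y ∈ D, S.sum = (S.card : ℂ) * y := by
  induction S using Multiset.induction_on with
  | empty => exact ⟨0, h0, by simp⟩
  | cons x S ih =>
    obtain ⟨y, hy, hsum⟩ := ih fun z hz => hS z (Multiset.mem_cons_of_mem hz)
    have hpos : (0 : ℝ) < S.card + 1 := by positivity
    have hne : (S.card : ℂ) + 1 ≠ 0 := by exact_mod_cast hpos.ne'
    refine ⟨(1 / (S.card + 1 : ℝ)) • x + (S.card / (S.card + 1 : ℝ)) • y,
      hD (hS x (Multiset.mem_cons_self x S)) hy (by positivity) (by positivity)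
        (by field_simp; ring), ?_⟩
    rw [Multiset.sum_cons, hsum, Multiset.card_cons]
    simp only [Complex.real_smul]
    push_cast
    field_simp

/-- Laguerre's theorem for the closed unit disc: a polar derivative with respect to a point of
the disc has no zeros in the disc. -/
lemma polarDerivative_ne_zero {Q : ℂ[X]} {k : ℕ} (hk : 0 < k) (hdeg : Q.natDegree ≤ k)
    (hQ : ∀ b : ℂ, ‖b‖ ≤ 1 → Q.eval b ≠ 0) {b c : ℂ} (hb : ‖b‖ ≤ 1) (hc : ‖c‖ ≤ 1) :
    k * Q.eval b + (c - b) * Q.derivative.eval b ≠ 0 := by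
  intro h
  have hQb := hQ b hb
  have hkC : (k : ℂ) ≠ 0 := by exact_mod_cast hk.ne'
  have h0 : (0 : ℂ) ∈ inverseExterior b := by simp [inverseExterior]
  have hD := convex_inverseExterior hb
  obtain ⟨y, hy, hsum⟩ := hD.exists_multiset_sum_eq h0
    (Q.roots.map fun r => 1 / (b - r)) (by
      intro x hx
      obtain ⟨r, hr, rfl⟩ := Multiset.mem_map.1 hx
      have hr0 : Q.eval r = 0 := (mem_roots'.1 hr).2
      have hr1 : 1 < ‖r‖ := by
        by_contra! hle
        exact hQ r hle hr0
      have hbr : b - r ≠ 0 := sub_ne_zero.2 fun e => hQb (e ▸ hr0)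
      rw [mem_inverseExterior_iff (one_div_ne_zero hbr)]
      simpa using hr1)
  rw [← (IsAlgClosed.splits Q).eval_derivative_div_eval_of_ne_zero hQb, Multiset.card_map] at hsum
  set d := Q.roots.card
  have hdk : d ≤ k := (card_roots' Q).trans hdeg
  have hkey : (k : ℂ) = (b - c) * (d * y) := by
    rw [← hsum]
    field_simp
    linear_combination h
  have hbc : b - c ≠ 0 := fun e => hkC (by rw [hkey, e, zero_mul])
  have hmem : (b - c)⁻¹ ∈ inverseExterior b := by
    have hdk' : (d : ℝ) / k ≤ 1 := div_le_one_of_le₀ (by exact_mod_cast hdk) (by positivity)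
    have := hD h0 hy (sub_nonneg.2 hdk') (by positivity : (0 : ℝ) ≤ d / k) (by ring)
    convert this using 1
    simp only [smul_zero, zero_add, Complex.real_smul]
    push_cast
    field_simp
    linear_combination hkey
  rw [mem_inverseExterior_iff (inv_ne_zero hbc)] at hmem
  simp at hmem
  linarith

lemma exists_polynomial_eval_eq_apply_mul_pow (L : ℂ[X] →ₗ[ℂ] ℂ) (k : ℕ) (g : ℂ[X]) :
    ∃ Q : ℂ[X], Q.natDegree ≤ k ∧ (∀ b, Q.eval b = L (g * (1 - C b * X) ^ k)) ∧
      ∀ b, Q.derivative.eval b = -k * L (g * X * (1 - C b * X) ^ (k - 1)) := by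
  induction k generalizing g with
  | zero => exact ⟨C (L g), by simp, by simp, by simp⟩
  | succ k ih =>
    obtain ⟨Q, hQd, hQ, hQ'⟩ := ih g
    obtain ⟨R, hRd, hR, hR'⟩ := ih (g * X)
    have hL : ∀ (b : ℂ) (q : ℂ[X]), b * L q = L (C b * q) := fun b q => by
      rw [← smul_eq_C_mul, map_smul, smul_eq_mul]
    refine ⟨Q - X * R, ?_, fun b => ?_, fun b => ?_⟩
    · refine (natDegree_sub_le _ _).trans (max_le (by omega) (natDegree_mul_le.trans ?_))
      rw [natDegree_X]
      omega
    · rw [eval_sub, eval_mul, eval_X, hQ, hR, hL, ← map_sub]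
      congr 1
      ring
    · rw [derivative_sub, derivative_mul, derivative_X, eval_sub, eval_add, eval_mul, eval_mul,
        eval_X, eval_one, hQ', hR', hR, Nat.add_sub_cancel]
      rcases k with _ | k
      · simp
      · have : L (g * X * (1 - C b * X) ^ (k + 1)) = L (g * X * (1 - C b * X) ^ k)
            - b * L (g * X * X * (1 - C b * X) ^ k) := by
          rw [hL, ← map_sub]
          congr 1
          ring
        simp only [Nat.add_sub_cancel]
        push_cast
        rw [this]
        ring

/-- A form of the Grace–Walsh–Szegő coincidence theorem. -/
lemma linearMap_apply_multiset_prod_ne_zero (L : ℂ[X] →ₗ[ℂ] ℂ) (s : Multiset ℂ)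
    (hs : ∀ c ∈ s, ‖c‖ ≤ 1) (g : ℂ[X])
    (h : ∀ b : ℂ, ‖b‖ ≤ 1 → L (g * (1 - C b * X) ^ s.card) ≠ 0) :
    L (g * (s.map fun c => 1 - C c * X).prod) ≠ 0 := by
  induction s using Multiset.induction_on generalizing g with
  | empty => simpa using h 0 (by simp)
  | cons c s ih =>
    rw [Multiset.map_cons, Multiset.prod_cons, ← mul_assoc]
    refine ih (fun x hx => hs x (Multiset.mem_cons_of_mem hx)) _ fun b hb => ?_
    rw [Multiset.card_cons] at h
    obtain ⟨Q, hQd, hQ, hQ'⟩ := exists_polynomial_eval_eq_apply_mul_pow L (s.card + 1) g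
    have := polarDerivative_ne_zero s.card.succ_pos hQd (fun b hb => hQ b ▸ h b hb) hb
      (hs c (Multiset.mem_cons_self c s))
    rw [hQ, hQ', Nat.add_sub_cancel] at this
    intro h0
    apply this
    have hL : ∀ (b : ℂ) (q : ℂ[X]), b * L q = L (C b * q) := fun b q => by
      rw [← smul_eq_C_mul, map_smul, smul_eq_mul]
    have h1 : L (g * (1 - C c * X) * (1 - C b * X) ^ s.card)
        = L (g * (1 - C b * X) ^ (s.card + 1))
          - (c - b) * L (g * X * (1 - C b * X) ^ s.card) := by
      rw [hL, ← map_sub, C_sub]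
      congr 1
      ring
    rw [h1] at h0
    push_cast
    linear_combination ((s.card : ℂ) + 1) * h0

lemma abs_arg_le_arcsin_norm_sub_one {x : ℂ} (hx : ‖x - 1‖ ≤ 1) :
    |arg x| ≤ Real.arcsin ‖x - 1‖ := by
  have hre : 0 ≤ x.re := by
    have := (abs_le.1 ((Complex.abs_re_le_norm (x - 1)).trans hx)).1
    simp at this
    linarith
  have key : |x.im| ≤ ‖x‖ * ‖x - 1‖ := by
    refine abs_le_of_sq_le_sq ?_ (by positivity)
    rw [mul_pow, Complex.sq_norm, Complex.sq_norm, normSq_apply, normSq_apply]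
    simp only [sub_re, sub_im, one_re, one_im, sub_zero]
    nlinarith [sq_nonneg (x.im ^ 2 + x.re * (x.re - 1))]
  rw [arg_of_re_nonneg hre]
  have h : |x.im / ‖x‖| ≤ ‖x - 1‖ := by
    rw [abs_div, abs_norm]
    exact div_le_of_le_mul₀ (norm_nonneg _) (norm_nonneg _) (by linarith)
  rw [abs_le] at h ⊢
  exact ⟨by rw [← Real.arcsin_neg]; exact Real.monotone_arcsin h.1,
    Real.monotone_arcsin h.2⟩

lemma eq_of_pow_eq_pow_of_norm_sub_one {n : ℕ} (hn : 2 ≤ n) {x y : ℂ}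
    (hx : ‖x - 1‖ < Real.sin (π / n)) (hy : ‖y - 1‖ ≤ Real.sin (π / n))
    (h : x ^ n = y ^ n) : x = y := by
  have hn0 : (0 : ℝ) < n := by positivity
  have hnC : (n : ℂ) ≠ 0 := by exact_mod_cast hn0.ne'
  have hs := Real.sin_le_one (π / n)
  have hpn : π / n ≤ π / 2 := by
    apply div_le_div_of_nonneg_left pi_pos.le (by norm_num)
    exact_mod_cast hn
  have hpn0 : 0 < π / n := by positivity
  have harc : Real.arcsin (Real.sin (π / n)) = π / n :=
    Real.arcsin_sin (by linarith [pi_pos]) hpn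
  have hx1 : |arg x| < π / n := by
    refine (abs_arg_le_arcsin_norm_sub_one (by linarith)).trans_lt ?_
    rw [← harc]
    exact Real.strictMonoOn_arcsin ⟨by linarith [norm_nonneg (x - 1)], by linarith⟩
      ⟨by linarith [norm_nonneg (x - 1)], hs⟩ hx
  have hy1 : |arg y| ≤ π / n := by
    refine (abs_arg_le_arcsin_norm_sub_one (by linarith)).trans ?_
    rw [← harc]
    exact Real.monotone_arcsin hy
  have hx0 : x ≠ 0 := by
    rintro rfl
    simp at hx
    linarith
  have hy0 : y ≠ 0 := by
    rintro rfl
    rw [zero_pow (by omega)] at h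
    exact hx0 (eq_zero_of_pow_eq_zero h)
  rw [← exp_log hx0, ← exp_log hy0, ← Complex.exp_nat_mul, ← Complex.exp_nat_mul,
    exp_eq_exp_iff_exists_int] at h
  obtain ⟨k, hk⟩ := h
  have him := congrArg Complex.im hk
  simp [Complex.log_im] at him
  have hlt : |arg x - arg y| < 2 * π / n := by
    calc |arg x - arg y| ≤ |arg x| + |arg y| := abs_sub _ _
      _ < 2 * π / n := by linarith [show 2 * π / n = π / n + π / n by ring]
  have hk0 : k = 0 := by
    have e : arg x - arg y = k * (2 * π / n) := by
      field_simp
      linarith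
    rw [e, abs_mul, abs_of_pos (by positivity : 0 < 2 * π / n)] at hlt
    have h1 : |(k : ℝ)| < 1 := by
      by_contra! hge
      nlinarith [show 0 < 2 * π / n by positivity]
    exact Int.abs_lt_one_iff.1 (by exact_mod_cast h1)
  rw [hk0] at hk
  rw [← exp_log hx0, ← exp_log hy0]
  congr 1
  apply mul_left_cancel₀ hnC
  simpa using hk

lemma exists_linearMap_derivative_eq_eval_sub (u v : ℂ) :
    ∃ L : ℂ[X] →ₗ[ℂ] ℂ, ∀ f : ℂ[X], L f.derivative = f.eval u - f.eval v := by
  refine ⟨Polynomial.lsum fun i =>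
    LinearMap.toSpanSingleton ℂ ℂ ((u ^ (i + 1) - v ^ (i + 1)) / (i + 1)), fun f => ?_⟩
  induction f using Polynomial.induction_on' with
  | add f g hf hg =>
    rw [derivative_add, map_add, hf, hg, eval_add, eval_add]
    ring
  | monomial k c =>
    rcases k with _ | k
    · simp
    · have : (k : ℂ) + 1 ≠ 0 := by exact_mod_cast k.succ_ne_zero
      rw [derivative_monomial, Nat.add_sub_cancel, lsum_apply, sum_monomial_index _ _ (by simp)]
      simp
      field_simp

/-- The Alexander–Kakeya univalence theorem. -/
lemma eq_of_eval_eq_of_norm_lt_sin {f : ℂ[X]} {n : ℕ} (hn : 2 ≤ n)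
    (hcard : f.derivative.roots.card + 1 = n)
    (hroots : ∀ c ∈ f.derivative.roots, 1 ≤ ‖c‖) {u v : ℂ}
    (hu : ‖u‖ < Real.sin (π / n)) (hv : ‖v‖ ≤ Real.sin (π / n))
    (h : f.eval u = f.eval v) : u = v := by
  by_contra huv
  obtain ⟨L, hL⟩ := exists_linearMap_derivative_eq_eval_sub u v
  have hnC : (n : ℂ) ≠ 0 := by norm_cast; omega
  set s := f.derivative.roots with hs
  have hlead : f.derivative.leadingCoeff ≠ 0 := by
    intro h0
    rw [leadingCoeff_eq_zero] at h0
    rw [hs, h0] at hcard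
    simp at hcard
    omega
  have hsplit : f.derivative = C (f.derivative.leadingCoeff * (s.map fun c => -c).prod) *
      (1 * ((s.map fun c => c⁻¹).map fun c => 1 - C c * X).prod) := by
    conv_lhs => rw [(IsAlgClosed.splits f.derivative).eq_prod_roots]
    rw [C_mul, mul_assoc, ← hs, map_multiset_prod, Multiset.map_map, one_mul, Multiset.map_map,
      ← Multiset.prod_map_mul]
    congr 2
    refine Multiset.map_congr rfl fun c hc => ?_
    have hc0 : c ≠ 0 := norm_pos_iff.1 (zero_lt_one.trans_le (hroots c hc))
    have : C c * C c⁻¹ = (1 : ℂ[X]) := by rw [← C_mul, mul_inv_cancel₀ hc0, C_1]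
    simp only [Function.comp, C_neg]
    linear_combination (-X) * this
  have hprod : (s.map fun c => -c).prod ≠ 0 := by
    intro h0
    rw [Multiset.prod_eq_zero_iff] at h0
    obtain ⟨c, hc, hc0⟩ := Multiset.mem_map.1 h0
    have := hroots c hc
    rw [neg_eq_zero.1 hc0] at this
    norm_num at this
  have h0 : L f.derivative = 0 := by rw [hL, h, sub_self]
  rw [hsplit, ← smul_eq_C_mul, map_smul, smul_eq_mul] at h0
  refine linearMap_apply_multiset_prod_ne_zero L (s.map fun c => c⁻¹) ?_ 1 ?_
    ((mul_eq_zero.1 h0).resolve_left (mul_ne_zero hlead hprod))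
  · intro c hc
    obtain ⟨d, hd, rfl⟩ := Multiset.mem_map.1 hc
    rw [norm_inv]
    exact inv_le_one_of_one_le₀ (hroots d hd)
  · intro b hb
    rw [Multiset.card_map, one_mul]
    by_cases hb0 : b = 0
    · have := hL X
      simp only [derivative_X, eval_X] at this
      simpa [hb0, this, sub_eq_zero] using huv
    have hder : (1 - C b * X) ^ s.card = C (-(b * n)⁻¹) * derivative ((1 - C b * X) ^ n) := by
      rw [← hcard, derivative_pow, Nat.add_sub_cancel, hcard]
      simp only [derivative_sub, derivative_one, derivative_C_mul, derivative_X]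
      have : C (-(b * n)⁻¹) * (C (n : ℂ) * -C b) = (1 : ℂ[X]) := by
        rw [← C_neg, ← C_mul, ← C_mul, ← C_1]
        congr 1
        field_simp
      linear_combination (-(1 - C b * X) ^ s.card) * this
    rw [hder, ← smul_eq_C_mul, map_smul, hL, smul_eq_mul]
    refine mul_ne_zero (by simp [hb0, hnC]) (sub_ne_zero.2 fun e => huv ?_)
    simp only [eval_pow, eval_sub, eval_one, eval_mul, eval_C, eval_X] at e
    have hle : ∀ w : ℂ, ‖(1 - b * w) - 1‖ ≤ ‖w‖ := fun w => by
      rw [sub_right_comm, sub_self, zero_sub, norm_neg, norm_mul]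
      exact mul_le_of_le_one_left (norm_nonneg w) hb
    have := eq_of_pow_eq_pow_of_norm_sub_one hn ((hle u).trans_lt hu) ((hle v).trans hv) e
    exact mul_left_cancel₀ hb0 (sub_right_injective this)

lemma exists_eval_eq_of_lt_norm_eval_derivative {f : ℂ[X]} {H h : ℝ → ℝ} {R : ℝ} {q : ℂ}
    (hR : 0 < R) (hH : ∀ r, HasDerivAt H (h r) r) (hH0 : H 0 = 0)
    (hh : ∀ r, 0 ≤ r → r < R → 0 ≤ h r)
    (hf : ∀ w : ℂ, ‖w‖ < R → h ‖w‖ < ‖f.derivative.eval w‖)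
    (hf0 : f.eval 0 = 0) (hq : ‖q‖ < H R) : ∃ u, ‖u‖ < R ∧ f.eval u = q := by
  have hHc : Continuous H := continuous_iff_continuousAt.2 fun r => (hH r).continuousAt
  have hmono : MonotoneOn H (Set.Icc 0 R) := by
    refine monotoneOn_of_hasDerivWithinAt_nonneg (f' := h) (convex_Icc 0 R) hHc.continuousOn
      (fun r _ => (hH r).hasDerivWithinAt) fun r hr => ?_
    rw [interior_Icc] at hr
    exact hh r hr.1.le hr.2
  have hcont : Continuous fun w : ℂ => ‖f.eval w - q‖ + H ‖w‖ :=
    (f.continuous.sub continuous_const).norm.add (hHc.comp continuous_norm)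
  obtain ⟨w, hw, hmin⟩ := (isCompact_closedBall (0 : ℂ) R).exists_isMinOn
    ⟨0, Metric.mem_closedBall_self hR.le⟩ hcont.continuousOn
  rw [isMinOn_iff] at hmin
  rw [mem_closedBall_zero_iff] at hw
  have hwR : ‖w‖ < R := by
    refine lt_of_le_of_ne hw fun e => ?_
    have := hmin 0 (Metric.mem_closedBall_self hR.le)
    simp only [hf0, norm_zero, hH0, zero_sub, norm_neg, e] at this
    linarith [norm_nonneg (f.eval w - q)]
  refine ⟨w, hwR, ?_⟩
  by_contra hne
  set D := f.derivative.eval w with hD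
  have hhw := hh _ (norm_nonneg w) hwR
  have hDpos : 0 < ‖D‖ := hhw.trans_lt (hf w hwR)
  have hD0 : D ≠ 0 := norm_pos_iff.1 hDpos
  set d := q - f.eval w with hd
  have hd0 : 0 < ‖d‖ := norm_pos_iff.2 (sub_ne_zero.2 (Ne.symm hne))
  set k := ‖d‖ / ‖D‖ with hk
  have hk0 : 0 < k := by positivity
  have hgap : k * h ‖w‖ < ‖d‖ := by
    rw [hk, div_mul_eq_mul_div, div_lt_iff₀ hDpos]
    exact mul_lt_mul_of_pos_left (hf w hwR) hd0
  obtain ⟨ε, hε, hε3⟩ : ∃ ε > 0, k * h ‖w‖ + 3 * ε = ‖d‖ :=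
    ⟨(‖d‖ - k * h ‖w‖) / 3, by linarith, by ring⟩
  have hline : HasDerivAt (fun s : ℝ => w + s * (d / D)) (d / D) 0 := by
    simpa using ((hasDerivAt_id (0 : ℝ)).ofReal_comp.mul_const (d / D)).const_add w
  have hfd : HasDerivAt (fun s : ℝ => f.eval (w + s * (d / D))) d 0 := by
    have h1 : HasDerivAt (fun z => f.eval z) D (w + ((0 : ℝ) : ℂ) * (d / D)) := by
      simpa using f.hasDerivAt w
    have := h1.comp (0 : ℝ) hline
    rwa [mul_div_cancel₀ _ hD0] at this
  have hHd : HasDerivAt (fun s : ℝ => H (‖w‖ + s * k)) (h ‖w‖ * k) 0 := by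
    have h1 : HasDerivAt H (h ‖w‖) (‖w‖ + 0 * k) := by simpa using hH ‖w‖
    have h2 : HasDerivAt (fun s : ℝ => ‖w‖ + s * k) k 0 := by
      simpa using ((hasDerivAt_id (0 : ℝ)).mul_const k).const_add ‖w‖
    exact h1.comp (0 : ℝ) h2
  have e1 := (hfd.isLittleO.def hε).filter_mono (nhdsWithin_le_nhds (s := Set.Ioi 0))
  have e2 := (hHd.isLittleO.def hε).filter_mono (nhdsWithin_le_nhds (s := Set.Ioi 0))
  have e3 : ∀ᶠ s : ℝ in nhdsWithin 0 (Set.Ioi 0), s < min 1 ((R - ‖w‖) / k) :=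
    nhdsWithin_le_nhds (Iio_mem_nhds (lt_min one_pos (div_pos (by linarith) hk0)))
  obtain ⟨s, h1, h2, h3, hs⟩ := (e1.and (e2.and (e3.and self_mem_nhdsWithin))).exists
  have hs0 : 0 < s := hs
  have hs1 : s < 1 := h3.trans_le (min_le_left _ _)
  have hsR : ‖w‖ + s * k ≤ R := by
    have := (lt_div_iff₀ hk0).1 (h3.trans_le (min_le_right _ _))
    linarith
  simp only [sub_zero, ofReal_zero, zero_mul, add_zero, Real.norm_eq_abs, abs_of_pos hs0,
    smul_eq_mul, Complex.real_smul] at h1 h2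
  have hnorm : ‖w + s * (d / D)‖ ≤ ‖w‖ + s * k := by
    refine (norm_add_le _ _).trans_eq ?_
    rw [norm_mul, norm_div, Complex.norm_real, Real.norm_eq_abs, abs_of_pos hs0]
  have hf1 : ‖f.eval (w + s * (d / D)) - q‖ ≤ ε * s + (1 - s) * ‖d‖ := by
    have e : f.eval (w + s * (d / D)) - q =
        (f.eval (w + s * (d / D)) - f.eval w - s * d) - ((1 - s : ℝ) : ℂ) * d := by
      rw [hd]
      push_cast
      ring
    rw [e]
    refine (norm_sub_le _ _).trans (add_le_add h1 (le_of_eq ?_))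
    rw [norm_mul, Complex.norm_real, Real.norm_eq_abs, abs_of_pos (by linarith)]
  have hH1 : H ‖w + s * (d / D)‖ ≤ H (‖w‖ + s * k) :=
    hmono ⟨norm_nonneg _, hnorm.trans hsR⟩ ⟨by positivity, hsR⟩ hnorm
  have hH2 := (abs_le.1 h2).2
  have hm := hmin (w + s * (d / D)) (mem_closedBall_zero_iff.2 (hnorm.trans hsR))
  have hdn : ‖f.eval w - q‖ = ‖d‖ := norm_sub_rev _ _
  rw [hdn] at hm
  nlinarith [mul_pos hε hs0]

lemma pow_card_le_norm_prod_sub (s : Multiset ℂ) (hs : ∀ c ∈ s, 1 ≤ ‖c‖) {w : ℂ} (hw : ‖w‖ ≤ 1) :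
    (1 - ‖w‖) ^ s.card ≤ ‖(s.map fun c => w - c).prod‖ := by
  induction s using Multiset.induction_on with
  | empty => simp
  | cons c s ih =>
    rw [Multiset.card_cons, Multiset.map_cons, Multiset.prod_cons, norm_mul, pow_succ']
    have hc := hs c (Multiset.mem_cons_self c s)
    have h1 : 1 - ‖w‖ ≤ ‖w - c‖ := by
      rw [norm_sub_rev]
      linarith [norm_sub_norm_le c w]
    exact mul_le_mul h1 (ih fun x hx => hs x (Multiset.mem_cons_of_mem hx))
      (pow_nonneg (by linarith) _) (norm_nonneg _)

lemma norm_sub_sq_of_norm_eq_one {c : ℂ} (hc : ‖c‖ = 1) (w : ℂ) :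
    ‖w - c‖ ^ 2 = (1 - ‖w‖) ^ 2 + 2 * (‖w‖ - inner ℝ w c) := by
  rw [norm_sub_sq_real, hc]
  ring

lemma exists_mul_le_norm_sub_mul_norm_sub {c d : ℂ} (hc : ‖c‖ = 1) (hd : ‖d‖ = 1) (hcd : c ≠ d) :
    ∃ δ > 0, ∀ w : ℂ, ‖w‖ ≤ 1 → (1 - ‖w‖) ^ 2 * (1 + δ * ‖w‖) ≤ ‖w - c‖ * ‖w - d‖ := by
  have hlt : ‖c + d‖ < 2 := by
    have h1 := parallelogram_law_with_norm ℝ c d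
    have h2 : 0 < ‖c - d‖ := norm_pos_iff.2 (sub_ne_zero.2 hcd)
    rw [hc, hd] at h1
    nlinarith [norm_nonneg (c + d)]
  set η := 2 - ‖c + d‖ with hη
  have hη0 : 0 < η := by linarith
  have hη2 : η ≤ 2 := by linarith [norm_nonneg (c + d)]
  refine ⟨η / 2, by positivity, fun w hw => ?_⟩
  have hr := norm_nonneg w
  have hwc : inner ℝ w c ≤ ‖w‖ := by simpa [hc] using real_inner_le_norm w c
  have hwd : inner ℝ w d ≤ ‖w‖ := by simpa [hd] using real_inner_le_norm w d
  have hsum : η * ‖w‖ ≤ (‖w‖ - inner ℝ w c) + (‖w‖ - inner ℝ w d) := by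
    have h1 := real_inner_le_norm w (c + d)
    rw [inner_add_right] at h1
    rw [hη]
    linarith
  refine le_of_sq_le_sq ?_ (by positivity)
  rw [mul_pow (‖w - c‖), norm_sub_sq_of_norm_eq_one hc, norm_sub_sq_of_norm_eq_one hd]
  set r := ‖w‖
  set A := r - inner ℝ w c
  set B := r - inner ℝ w d
  have hA : 0 ≤ A := sub_nonneg.2 hwc
  have hB : 0 ≤ B := sub_nonneg.2 hwd
  have h1 : (1 - r) ^ 2 ≤ 1 := by nlinarith
  have h2 : (1 + η / 2 * r) ^ 2 ≤ 1 + 2 * (η * r) := by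
    nlinarith [mul_nonneg hη0.le hr, mul_le_mul hη2 hw hr (by norm_num)]
  calc ((1 - r) ^ 2 * (1 + η / 2 * r)) ^ 2
      = (1 - r) ^ 2 * ((1 - r) ^ 2 * (1 + η / 2 * r) ^ 2) := by ring
    _ ≤ (1 - r) ^ 2 * ((1 - r) ^ 2 * (1 + 2 * (η * r))) := by gcongr
    _ ≤ (1 - r) ^ 2 * ((1 - r) ^ 2 + 2 * (η * r)) := by
        gcongr
        nlinarith [mul_nonneg hη0.le hr]
    _ ≤ (1 - r) ^ 2 * ((1 - r) ^ 2 + 2 * (A + B)) := by gcongr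
    _ ≤ ((1 - r) ^ 2 + 2 * A) * ((1 - r) ^ 2 + 2 * B) := by
        nlinarith [mul_nonneg hA hB]

lemma eq_replicate_or_exists_le_norm_prod_sub (s : Multiset ℂ) (hs0 : s ≠ 0)
    (hs : ∀ c ∈ s, 1 ≤ ‖c‖) :
    (∃ c, ‖c‖ = 1 ∧ s = Multiset.replicate s.card c) ∨
      ∃ δ > 0, ∀ w : ℂ, ‖w‖ ≤ 1 →
        (1 - ‖w‖) ^ s.card * (1 + δ * ‖w‖) ≤ ‖(s.map fun c => w - c).prod‖ := by
  by_cases hex : ∃ c ∈ s, 1 < ‖c‖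
  · obtain ⟨c, hc, hc1⟩ := hex
    obtain ⟨t, rfl⟩ := Multiset.exists_cons_of_mem hc
    refine Or.inr ⟨‖c‖ - 1, by linarith, fun w hw => ?_⟩
    rw [Multiset.card_cons, Multiset.map_cons, Multiset.prod_cons, norm_mul, pow_succ,
      mul_assoc, mul_comm]
    have h1 : (1 - ‖w‖) * (1 + (‖c‖ - 1) * ‖w‖) ≤ ‖w - c‖ := by
      have := norm_sub_norm_le c w
      rw [norm_sub_rev] at this
      nlinarith [norm_nonneg w, sq_nonneg (1 - ‖w‖)]
    exact mul_le_mul h1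
      (pow_card_le_norm_prod_sub t (fun x hx => hs x (Multiset.mem_cons_of_mem hx)) hw)
      (pow_nonneg (by linarith) _) (norm_nonneg _)
  push Not at hex
  have hs1 : ∀ c ∈ s, ‖c‖ = 1 := fun c hc => le_antisymm (hex c hc) (hs c hc)
  obtain ⟨c, hc⟩ := Multiset.exists_mem_of_ne_zero hs0
  by_cases hall : ∀ d ∈ s, d = c
  · exact Or.inl ⟨c, hs1 c hc, Multiset.eq_replicate.2 ⟨rfl, hall⟩⟩
  push Not at hall
  obtain ⟨d, hd, hdc⟩ := hall
  obtain ⟨δ, hδ, hbound⟩ := exists_mul_le_norm_sub_mul_norm_sub (hs1 d hd) (hs1 c hc) hdc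
  obtain ⟨t, rfl⟩ := Multiset.exists_cons_of_mem hd
  obtain ⟨t, rfl⟩ := Multiset.exists_cons_of_mem
    ((Multiset.mem_cons.1 hc).resolve_left (Ne.symm hdc))
  refine Or.inr ⟨δ, hδ, fun w hw => ?_⟩
  simp only [Multiset.card_cons, Multiset.map_cons, Multiset.prod_cons]
  rw [← mul_assoc, norm_mul, norm_mul]
  calc (1 - ‖w‖) ^ (t.card + 1 + 1) * (1 + δ * ‖w‖)
      = ((1 - ‖w‖) ^ 2 * (1 + δ * ‖w‖)) * (1 - ‖w‖) ^ t.card := by ring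
    _ ≤ _ := mul_le_mul (hbound w hw)
      (pow_card_le_norm_prod_sub t (fun x hx => hs x
        (Multiset.mem_cons_of_mem (Multiset.mem_cons_of_mem hx))) hw)
      (pow_nonneg (by linarith) _) (by positivity)

lemma sum_sq_norm_sub_mul_pow {n : ℕ} (hn : 2 ≤ n) {ω : ℂ} (hω : IsPrimitiveRoot ω n) (ζ : ℂ)
    {c : ℂ} (hc : ‖c‖ = 1) :
    ∑ j ∈ Finset.range n, ‖ζ - c * ω ^ j‖ ^ 2 = n * (‖ζ‖ ^ 2 + 1) := by
  have hω1 : ‖ω‖ = 1 := hω.norm'_eq_one (by omega)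
  have h : ∀ j, ‖ζ - c * ω ^ j‖ ^ 2 = (‖ζ‖ ^ 2 + 1) - 2 * inner ℝ ζ (c * ω ^ j) := fun j => by
    rw [norm_sub_sq_real, norm_mul, norm_pow, hω1, hc]
    ring
  simp only [h]
  rw [Finset.sum_sub_distrib, ← Finset.mul_sum, ← inner_sum, ← Finset.mul_sum,
    hω.geom_sum_eq_zero (by omega)]
  simp
  ring

/-- A comparison function: an antiderivative of `n (1 - r) ^ (n - 1) (1 + δ r)`. -/
lemma hasDerivAt_comparison (m : ℕ) (δ r : ℝ) :
    HasDerivAt (fun r : ℝ => 1 - (1 - r) ^ (m + 1) +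
      δ * ((1 - (1 - r) ^ (m + 1) * (1 + (m + 1) * r)) / (m + 2)))
      ((m + 1) * ((1 - r) ^ m * (1 + δ * r))) r := by
  have h1 : HasDerivAt (fun r : ℝ => (1 - r) ^ (m + 1)) (-((m + 1) * (1 - r) ^ m)) r := by
    have := ((hasDerivAt_id r).const_sub 1).fun_pow (m + 1)
    simpa using this
  have h2 : HasDerivAt (fun r : ℝ => 1 + ((m : ℝ) + 1) * r) (m + 1) r := by
    simpa using ((hasDerivAt_id r).const_mul ((m : ℝ) + 1)).const_add 1
  have := (h1.const_sub 1).add ((((h1.mul h2).const_sub 1).div_const ((m : ℝ) + 2)).const_mul δ)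
  refine this.congr_deriv ?_
  have : (m : ℝ) + 2 ≠ 0 := by positivity
  field_simp
  ring

lemma exists_eval_eq_of_le_norm_eval_derivative {f : ℂ[X]} {m : ℕ} {δ R : ℝ} {q : ℂ}
    (hδ : 0 < δ) (hR : 0 < R) (hR1 : R ≤ 1)
    (hf : ∀ w : ℂ, ‖w‖ ≤ 1 →
      (m + 1) * ((1 - ‖w‖) ^ m * (1 + δ * ‖w‖)) ≤ ‖f.derivative.eval w‖)
    (hf0 : f.eval 0 = 0) (hq : ‖q‖ ≤ 1 - (1 - R) ^ (m + 1)) : ∃ u, ‖u‖ < R ∧ f.eval u = q := by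
  set K := δ * ((1 - (1 - R) ^ (m + 1) * (1 + (m + 1) * R)) / (m + 2)) with hK
  have hK0 : 0 < K := by
    have h1 : 1 + ((m : ℝ) + 1) * R ≤ (1 + R) ^ (m + 1) := by
      have := one_add_mul_le_pow (by linarith : -2 ≤ R) (m + 1)
      push_cast at this
      exact this
    have h2 : (1 - R) ^ (m + 1) * (1 + (m + 1) * R) ≤ (1 - R ^ 2) ^ (m + 1) := by
      calc _ ≤ (1 - R) ^ (m + 1) * (1 + R) ^ (m + 1) :=
            mul_le_mul_of_nonneg_left h1 (pow_nonneg (by linarith) _)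
        _ = _ := by rw [← mul_pow]; ring
    have h3 : (1 - R ^ 2) ^ (m + 1) < 1 :=
      pow_lt_one₀ (by nlinarith) (by nlinarith) (by omega)
    exact mul_pos hδ (div_pos (by linarith) (by positivity))
  set M := 1 - (1 - R) ^ (m + 1) with hM
  have hM0 : 0 ≤ M := (norm_nonneg q).trans hq
  obtain ⟨t, ht0, ht1, ht⟩ : ∃ t : ℝ, 0 < t ∧ t < 1 ∧ M < t * (M + K) :=
    ⟨(M + K / 2) / (M + K), by positivity, by rw [div_lt_one (by positivity)]; linarith,
      by rw [div_mul_cancel₀ _ (by positivity)]; linarith⟩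
  refine exists_eval_eq_of_lt_norm_eval_derivative hR
    (fun r => (hasDerivAt_comparison m δ r).const_mul t) (by simp) (fun r hr hrR => ?_)
    (fun w hw => ?_) hf0 (hq.trans_lt ht)
  · have : 0 ≤ 1 - r := by linarith
    positivity
  · refine lt_of_lt_of_le (mul_lt_of_lt_one_left ?_ ht1) (hf w (by linarith))
    have : 0 < 1 - ‖w‖ := by linarith
    positivity

lemma roots_derivative_ne_replicate {n : ℕ} (hn : 2 ≤ n) {p : ℂ[X]} (hmonic : p.Monic)
    (hdeg : p.natDegree = n) (hroots : ∀ x, p.eval x = 0 → ‖x‖ ≤ 1) {a : ℂ} (ha : ‖a‖ < 1)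
    (hpa : p.eval a = 0) {c : ℂ} (hc : ‖c‖ = 1) :
    (p.comp (X + C a)).derivative.roots ≠ Multiset.replicate (n - 1) c := by
  intro hrep
  set f := p.comp (X + C a) with hf
  have hfdeg : f.natDegree = n := by rw [hf, natDegree_comp, natDegree_X_add_C, mul_one, hdeg]
  have hfmonic : f.Monic := hmonic.comp_X_add_C a
  have hder : f.derivative = C (n : ℂ) * (X - C c) ^ (n - 1) := by
    rw [(IsAlgClosed.splits f.derivative).eq_prod_roots, hrep, leadingCoeff_derivative,
      hfmonic.leadingCoeff, hfdeg]
    simp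
  have hconst : f - (X - C c) ^ n = C ((f - (X - C c) ^ n).coeff 0) := by
    apply eq_C_of_derivative_eq_zero
    rw [derivative_sub, hder, derivative_X_sub_C_pow, sub_self]
  set k := (f - (X - C c) ^ n).coeff 0
  have heval : ∀ x, f.eval x = (x - c) ^ n + k := fun x => by
    have := congrArg (eval x) hconst
    simp only [eval_sub, eval_pow, eval_X, eval_C] at this
    linear_combination this
  have hfe : ∀ x, f.eval x = p.eval (x + a) := fun x => by simp [hf]
  have hk : (-c) ^ n + k = 0 := by
    rw [← zero_sub, ← heval, hfe, zero_add, hpa]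
  have hω := Complex.isPrimitiveRoot_exp n (by omega)
  set ω := Complex.exp (2 * π * I / n)
  have hle : ∀ j, ‖(a + c) - c * ω ^ j‖ ≤ 1 := fun j => by
    apply hroots
    have : p.eval ((a + c) - c * ω ^ j) = f.eval (c - c * ω ^ j) := by
      rw [hfe]
      congr 1
      ring
    rw [this, heval, ← hk]
    congr 1
    rw [sub_right_comm, sub_self, zero_sub, ← neg_mul, mul_pow, ← pow_mul, mul_comm j, pow_mul,
      hω.pow_eq_one, one_pow, mul_one]
  have hsum := sum_sq_norm_sub_mul_pow hn hω (a + c) hc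
  have hlt : ∑ j ∈ Finset.range n, ‖(a + c) - c * ω ^ j‖ ^ 2 < ∑ _j ∈ Finset.range n, (1 : ℝ) := by
    refine Finset.sum_lt_sum (fun j _ => pow_le_one₀ (norm_nonneg _) (hle j))
      ⟨0, Finset.mem_range.2 (by omega), pow_lt_one₀ (norm_nonneg _) ?_ two_ne_zero⟩
    simpa using ha
  rw [hsum, Finset.sum_const, Finset.card_range, nsmul_eq_mul, mul_one] at hlt
  have hn0 : (0 : ℝ) < n := by positivity
  nlinarith [mul_nonneg hn0.le (sq_nonneg ‖a + c‖)]

theorem stmt_4 (n : ℕ) (hn : 2 ≤ n) (a : ℝ) (ha0 : 0 < a) (ha1 : a < 1)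
    (z : ℕ → ℂ) (hz : ∀ k ∈ Finset.range (n - 1), ‖z k‖ ≤ 1)
    (p : Polynomial ℂ)
    (hp : p = (X - C (a : ℂ)) * ∏ k ∈ Finset.range (n - 1), (X - C (z k)))
    (hρ : ∀ ζ : ℂ, p.derivative.eval ζ = 0 → 1 ≤ ‖ζ - (a : ℂ)‖)
    (lam : ℝ) (hlam0 : 0 < lam)
    (hlam1 : 1 - (1 - ‖p.eval 0‖) ^ ((1 : ℝ) / n) ≤ lam)
    (hlam2 : lam ≤ Real.sin (Real.pi / n)) :
    ∃! z₀ : ℂ, ‖z₀ - (a : ℂ)‖ ≤ lam ∧ p.eval z₀ = p.eval 0 := by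
  obtain ⟨m, rfl⟩ : ∃ m, n = m + 1 := ⟨n - 1, by omega⟩
  rw [Nat.add_sub_cancel] at hz hp
  have hmonic : p.Monic := by
    rw [hp]
    exact (monic_X_sub_C _).mul (monic_prod_of_monic _ _ fun k _ => monic_X_sub_C _)
  have hdeg : p.natDegree = m + 1 := by
    rw [hp, (monic_X_sub_C _).natDegree_mul (monic_prod_of_monic _ _ fun k _ => monic_X_sub_C _),
      natDegree_prod_of_monic _ _ fun k _ => monic_X_sub_C _]
    simp [add_comm]
  have heval : ∀ x, p.eval x = (x - a) * ∏ k ∈ Finset.range m, (x - z k) := fun x => by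
    simp [hp, eval_prod]
  have ha : ‖(a : ℂ)‖ < 1 := by rwa [Complex.norm_real, Real.norm_eq_abs, abs_of_pos ha0]
  have hpa : p.eval (a : ℂ) = 0 := by rw [heval, sub_self, zero_mul]
  have hroots : ∀ x, p.eval x = 0 → ‖x‖ ≤ 1 := fun x hx => by
    rw [heval, mul_eq_zero, Finset.prod_eq_zero_iff] at hx
    rcases hx with hx | ⟨k, hk, hx⟩
    · rw [sub_eq_zero.1 hx]
      exact ha.le
    · rw [sub_eq_zero.1 hx]
      exact hz k hk
  have hp0 : ‖p.eval 0‖ ≤ 1 := by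
    rw [heval, norm_mul, norm_prod]
    refine mul_le_one₀ (by simpa using ha.le) (by positivity)
      (Finset.prod_le_one (fun _ _ => norm_nonneg _) fun k hk => ?_)
    simpa using hz k hk
  have hlam_le : lam ≤ 1 := hlam2.trans (Real.sin_le_one _)
  set f := p.comp (X + C (a : ℂ)) with hf
  have hfe : ∀ x, f.eval x = p.eval (x + a) := fun x => by simp [hf]
  have hfdeg : f.natDegree = m + 1 := by rw [hf, natDegree_comp, natDegree_X_add_C, mul_one, hdeg]
  have hfmonic : f.Monic := hmonic.comp_X_add_C _
  have hcard : f.derivative.roots.card = m := by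
    rw [← (IsAlgClosed.splits f.derivative).natDegree_eq_card_roots, natDegree_derivative, hfdeg,
      Nat.add_sub_cancel]
  have hcrit : ∀ c ∈ f.derivative.roots, 1 ≤ ‖c‖ := fun c hc => by
    have h := (mem_roots'.1 hc).2
    have := hρ (c + a) (by simpa [hf, derivative_comp] using h)
    rwa [add_sub_cancel_right] at this
  have hq : ‖p.eval 0‖ ≤ 1 - (1 - lam) ^ (m + 1) := by
    have h1 : 1 - lam ≤ (1 - ‖p.eval 0‖) ^ ((1 : ℝ) / (m + 1 : ℕ)) := by linarith
    have h2 := pow_le_pow_left₀ (by linarith) h1 (m + 1)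
    rw [one_div, Real.rpow_inv_natCast_pow (by linarith) (by omega)] at h2
    linarith
  have hroots_ne : f.derivative.roots ≠ 0 := by
    rw [← Multiset.card_pos, hcard]
    omega
  rcases eq_replicate_or_exists_le_norm_prod_sub _ hroots_ne hcrit with
    ⟨c, hc, hrep⟩ | ⟨δ, hδ, hbound⟩
  · rw [hcard] at hrep
    exact absurd hrep (roots_derivative_ne_replicate hn hmonic hdeg hroots ha hpa hc)
  obtain ⟨u, hu, hfu⟩ := exists_eval_eq_of_le_norm_eval_derivative (f := f) (m := m) hδ hlam0
    hlam_le (fun w hw => by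
      rw [(IsAlgClosed.splits f.derivative).eval_eq_prod_roots, norm_mul, leadingCoeff_derivative,
        hfmonic.leadingCoeff, hfdeg]
      have h1 := hbound w hw
      rw [hcard] at h1
      have h2 : ‖(((m + 1 : ℕ) : ℂ))‖ = (m : ℝ) + 1 := by
        rw [Complex.norm_natCast]
        push_cast
        rfl
      rw [one_mul, h2]
      exact mul_le_mul_of_nonneg_left h1 (by positivity)) (by rw [hfe, zero_add, hpa]) hq
  refine ⟨u + a, ⟨by simpa using hu.le, by rw [← hfe, hfu]⟩, fun y hy => ?_⟩
  have := eq_of_eval_eq_of_norm_lt_sin hn (by rw [hcard]) hcrit (hu.trans_le hlam2)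
    (hy.1.trans hlam2) (by rw [hfu, hfe, sub_add_cancel, hy.2])
  rw [this, sub_add_cancel]
end
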